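/- arXiv:1109.5020 — 2 statements merged into one kernel-verified Lean document; each statement's English description precedes it below -/
import Mathlib

section
/- Let k ≥ 0, N ≥ 3 and p = N/2. Then γ_{N/2,k} > 0; that is, there exists c > 0 such that ‖a − μ_k‖_{L^{N/2}(B_1)} ≥ c for every a ∈ Γ_k. -/
open MeasureTheory Set Filter

noncomputable section

/-- The measure of the (N-1)-dimensional unit sphere in `ℝ^N`. -/
def omegaN (N : ℕ) : ℝ :=
  N * (volume (Metric.ball (0 : EuclideanSpace ℝ (Fin N)) 1)).toReal

/-- `u` is a radial Neumann solution of `Δu + a u = 0` on the unit ball of `ℝ^N`,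
with explicit derivative function `u'` : `u` is continuous on `[0,1]`, differentiable on
`(0,1]`, satisfies the integrated radial equation
`r^(N-1) u'(r) = -∫_0^r s^(N-1) a(s) u(s) ds` on `(0,1]`, and `u'(1) = 0`. -/
def IsRadialNeumannSolutionDeriv (N : ℕ) (a u u' : ℝ → ℝ) : Prop :=
  ContinuousOn u (Icc 0 1) ∧
  (∀ r ∈ Ioc (0:ℝ) 1, HasDerivAt u (u' r) r) ∧
  (∀ r ∈ Ioc (0:ℝ) 1,
    r ^ (N - 1) * u' r = - ∫ s in (0:ℝ)..r, s ^ (N - 1) * a s * u s) ∧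
  u' 1 = 0

/-- `u` is a radial Neumann solution of `Δu + a u = 0` on the unit ball of `ℝ^N`. -/
def IsRadialNeumannSolution (N : ℕ) (a u : ℝ → ℝ) : Prop :=
  ∃ u' : ℝ → ℝ, IsRadialNeumannSolutionDeriv N a u u'

/-- `u` is not identically zero on `[0,1]`. -/
def NontrivialSol (u : ℝ → ℝ) : Prop := ∃ r ∈ Icc (0:ℝ) 1, u r ≠ 0

/-- `μ ≺ a` : `a(r) ≥ μ` for a.e. `r ∈ (0,1)` and `a(r) > μ` on a set of positive measure. -/
def Prec (μ : ℝ) (a : ℝ → ℝ) : Prop :=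
  (∀ᵐ r ∂(volume.restrict (Ioo (0:ℝ) 1)), μ ≤ a r) ∧
  0 < volume {r ∈ Ioo (0:ℝ) 1 | μ < a r}

/-- A radial function `a` belongs to `L^p(B_1)` (finite `p`). -/
def RadialMemLp (N : ℕ) (p : ℝ) (a : ℝ → ℝ) : Prop :=
  IntegrableOn (fun r => r ^ (N - 1) * |a r| ^ p) (Ioo (0:ℝ) 1)

/-- A radial function `a` belongs to `L^∞(B_1)`. -/
def RadialMemLinfty (a : ℝ → ℝ) : Prop :=
  ∃ C : ℝ, ∀ᵐ r ∂(volume.restrict (Ioo (0:ℝ) 1)), |a r| ≤ C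

/-- The `L^p(B_1)` norm of a radial function (finite `p`):
`(ω_N ∫_0^1 r^(N-1) |a(r)|^p dr)^(1/p)`. -/
def radialLpNorm (N : ℕ) (p : ℝ) (a : ℝ → ℝ) : ℝ :=
  (omegaN N * ∫ r in (0:ℝ)..1, r ^ (N - 1) * |a r| ^ p) ^ (1 / p)

/-- The `L^∞(B_1)` norm of a radial function: essential supremum of `|a|` on `(0,1)`. -/
def radialLinftyNorm (a : ℝ → ℝ) : ℝ :=
  essSup (fun r => |a r|) (volume.restrict (Ioo (0:ℝ) 1))

/-- The admissible class `Γ_k` at level `μk`: radial measurable `a` with `μk ≺ a`, such that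
`Δu + a u = 0` has a nontrivial radial Neumann solution, and `a ∈ L^{N/2}(B_1)` if `N ≥ 3`,
or `a ∈ L^q(B_1)` for some `q ∈ (1,∞]` if `N = 2`. -/
def GammaSet (N : ℕ) (μk : ℝ) (a : ℝ → ℝ) : Prop :=
  Measurable a ∧ Prec μk a ∧
  (∃ u : ℝ → ℝ, IsRadialNeumannSolution N a u ∧ NontrivialSol u) ∧
  (if 3 ≤ N then RadialMemLp N ((N : ℝ) / 2) a
   else (∃ q : ℝ, 1 < q ∧ RadialMemLp N q a) ∨ RadialMemLinfty a)

/-- The Lyapunov constant `γ_{p,k}` for finite `p`. -/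
def gammaLyap (N : ℕ) (μk : ℝ) (p : ℝ) : ℝ :=
  sInf {t : ℝ | ∃ a : ℝ → ℝ, GammaSet N μk a ∧ RadialMemLp N p a ∧
    t = radialLpNorm N p (fun r => a r - μk)}

/-- The Lyapunov constant `γ_{∞,k}`. -/
def gammaLyapInfty (N : ℕ) (μk : ℝ) : ℝ :=
  sInf {t : ℝ | ∃ a : ℝ → ℝ, GammaSet N μk a ∧ RadialMemLinfty a ∧
    t = radialLinftyNorm (fun r => a r - μk)}

/-- `(μ, φ)` is the `k`-th radial Neumann eigenpair of `-Δ` on `B_1 ⊆ ℝ^N`: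
`μ ≥ 0`, `φ` is a nontrivial radial Neumann solution of `Δφ + μ φ = 0` having exactly `k`
zeros in `(0,1)`, all simple, given by `rz k < rz (k-1) < ⋯ < rz 1`. -/
def IsRadialNeumannEigenpair (N k : ℕ) (μ : ℝ) (φ : ℝ → ℝ) (rz : ℕ → ℝ) : Prop :=
  0 ≤ μ ∧
  IsRadialNeumannSolution N (fun _ => μ) φ ∧ NontrivialSol φ ∧
  (∀ i, 1 ≤ i → i ≤ k → rz i ∈ Ioo (0:ℝ) 1) ∧
  (∀ i j, 1 ≤ i → i < j → j ≤ k → rz j < rz i) ∧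
  (∀ x ∈ Ioo (0:ℝ) 1, (φ x = 0 ↔ ∃ i, 1 ≤ i ∧ i ≤ k ∧ x = rz i)) ∧
  (∀ i, 1 ≤ i → i ≤ k → ∃ d : ℝ, d ≠ 0 ∧ HasDerivAt φ d (rz i))

/-- `u` (with derivative `u'`) is a radial `H^1` solution of `Δu + a u = 0` in `B_1`:
continuous on `(0,1]`, differentiable on `(0,1)`, satisfying the integrated radial equation
between any two radii, with finite radial `H^1` energy. -/
def IsRadialH1Solution (N : ℕ) (a u u' : ℝ → ℝ) : Prop :=
  ContinuousOn u (Ioc 0 1) ∧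
  (∀ r ∈ Ioo (0:ℝ) 1, HasDerivAt u (u' r) r) ∧
  (∀ s ∈ Ioo (0:ℝ) 1, ∀ r ∈ Ioo (0:ℝ) 1, s < r →
    r ^ (N - 1) * u' r - s ^ (N - 1) * u' s
      = - ∫ t in s..r, t ^ (N - 1) * a t * u t) ∧
  IntegrableOn (fun r => r ^ (N - 1) * ((u' r) ^ 2 + (u r) ^ 2)) (Ioo (0:ℝ) 1)

/-- The Sobolev quotient: infimum of `(∫_{B_ρ} |∇w|²) / (∫_{B_ρ} |w|^q)^{2/q}` over nontrivial
`C^1` functions `w : ℝ^N → ℝ` with compact support contained in the ball `B_ρ`. -/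
def sobolevQuot (N : ℕ) (q : ℝ) (ρ : ℝ) : ℝ :=
  sInf {t : ℝ | ∃ w : EuclideanSpace ℝ (Fin N) → ℝ,
    ContDiff ℝ 1 w ∧ (∃ x, w x ≠ 0) ∧ tsupport w ⊆ Metric.ball 0 ρ ∧
    t = (∫ x in Metric.ball (0 : EuclideanSpace ℝ (Fin N)) ρ, ‖fderiv ℝ w x‖ ^ 2) /
        (∫ x in Metric.ball (0 : EuclideanSpace ℝ (Fin N)) ρ, |w x| ^ q) ^ (2 / q)}

/-- `w`, with derivative `w'`, is continuous on `[0,1]`, differentiable on `(0,1]`, and its radial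
flux `r^(m+2) w'(r)` in dimension `m + 3` is `-∫_0^r g`, with zero flux at `r = 1`. -/
structure RadialFlux (m : ℕ) (w w' g : ℝ → ℝ) : Prop where
  continuousOn : ContinuousOn w (Icc 0 1)
  hasDerivAt : ∀ r ∈ Ioc (0:ℝ) 1, HasDerivAt w (w' r) r
  intervalIntegrable : IntervalIntegrable g volume 0 1
  flux : ∀ r ∈ Ioc (0:ℝ) 1, r ^ (m + 2) * w' r = - ∫ s in (0:ℝ)..r, g s
  neumann : w' 1 = 0

/-- Integration by parts of a primitive of an integrable function against a `C^1` function. -/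
lemma integral_mul_eq_sub_integral_primitive_mul {g v v' : ℝ → ℝ} {δ : ℝ}
    (hδ : 0 < δ) (hδ1 : δ ≤ 1) (hg : IntervalIntegrable g volume 0 1)
    (hv : ∀ r ∈ Icc δ 1, HasDerivAt v (v' r) r) (hv' : ContinuousOn v' (Icc δ 1)) :
    ∫ s in δ..1, g s * v s =
      (∫ s in (0:ℝ)..1, g s) * v 1 - (∫ s in (0:ℝ)..δ, g s) * v δ
        - ∫ s in δ..1, (∫ t in (0:ℝ)..s, g t) * v' s := by
  have hu : uIcc δ 1 = Icc δ 1 := uIcc_of_le hδ1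
  have hG : AbsolutelyContinuousOnInterval (fun x ↦ ∫ t in (0:ℝ)..x, g t) δ 1 := by
    refine (hg.absolutelyContinuousOnInterval_intervalIntegral (c := 0) (by simp)).mono ?_
    rw [hu, uIcc_of_le zero_le_one]
    exact Icc_subset_Icc_left hδ.le
  have hV : AbsolutelyContinuousOnInterval v δ 1 := by
    obtain ⟨C, hC⟩ := isCompact_Icc.exists_bound_of_continuousOn hv'
    refine LipschitzOnWith.absolutelyContinuousOnInterval (K := C.toNNReal) ?_
    rw [hu]
    refine (convex_Icc δ 1).lipschitzOnWith_of_nnnorm_hasDerivWithin_le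
      (fun x hx ↦ (hv x hx).hasDerivWithinAt) (fun x hx ↦ ?_)
    rw [← NNReal.coe_le_coe, coe_nnnorm]
    exact (hC x hx).trans (Real.le_coe_toNNReal C)
  have key := hG.integral_mul_deriv_eq_deriv_mul hV
  have h1 : ∫ x in δ..1, deriv (fun x ↦ ∫ t in (0:ℝ)..x, g t) x * v x = ∫ s in δ..1, g s * v s := by
    refine intervalIntegral.integral_congr_ae ?_
    filter_upwards [hg.ae_hasDerivAt_integral] with x hx hxm
    rw [uIoc_of_le hδ1] at hxm
    rw [(hx (by rw [uIcc_of_le zero_le_one]; exact ⟨by linarith [hxm.1], hxm.2⟩) 0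
      (by simp)).deriv]
  have h2 : ∫ x in δ..1, (∫ t in (0:ℝ)..x, g t) * deriv v x
      = ∫ s in δ..1, (∫ t in (0:ℝ)..s, g t) * v' s := by
    refine intervalIntegral.integral_congr fun x hx ↦ ?_
    rw [hu] at hx
    simp only [(hv x hx).deriv]
  rw [h1, h2] at key
  linarith

namespace RadialFlux

variable {m : ℕ} {w w' g v v' h : ℝ → ℝ}

lemma sub_const_mul (hw : RadialFlux m w w' g) (hv : RadialFlux m v v' h) (t : ℝ) :
    RadialFlux m (fun r ↦ w r - t * v r) (fun r ↦ w' r - t * v' r) (fun r ↦ g r - t * h r) where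
  continuousOn := hw.continuousOn.sub (continuousOn_const.mul hv.continuousOn)
  hasDerivAt r hr := (hw.hasDerivAt r hr).sub ((hv.hasDerivAt r hr).const_mul t)
  intervalIntegrable := hw.intervalIntegrable.sub (hv.intervalIntegrable.const_mul t)
  flux r hr := by
    have hs : uIcc 0 r ⊆ uIcc (0:ℝ) 1 := by
      rw [uIcc_of_le hr.1.le, uIcc_of_le zero_le_one]
      exact Icc_subset_Icc_right hr.2
    rw [intervalIntegral.integral_sub (hw.intervalIntegrable.mono_set hs)
      ((hv.intervalIntegrable.mono_set hs).const_mul t), intervalIntegral.integral_const_mul]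
    linear_combination hw.flux r hr - t * hv.flux r hr
  neumann := by rw [hw.neumann, hv.neumann]; ring

lemma integral_eq_zero (hw : RadialFlux m w w' g) : ∫ s in (0:ℝ)..1, g s = 0 := by
  have := hw.flux 1 (by simp)
  rw [hw.neumann] at this
  linarith

lemma continuousOn_primitive (hw : RadialFlux m w w' g) :
    ContinuousOn (fun x ↦ ∫ s in (0:ℝ)..x, g s) (Icc 0 1) := by
  have := intervalIntegral.continuousOn_primitive_interval' hw.intervalIntegrable
    (a := 0) (by simp)
  rwa [uIcc_of_le zero_le_one] at this

lemma continuousOn_deriv (hw : RadialFlux m w w' g) {δ : ℝ} (hδ : 0 < δ) :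
    ContinuousOn w' (Icc δ 1) := by
  have h1 : ContinuousOn (fun x ↦ -(∫ s in (0:ℝ)..x, g s) / x ^ (m + 2)) (Icc δ 1) := by
    refine ((hw.continuousOn_primitive.mono (Icc_subset_Icc_left hδ.le)).neg).div
      (by fun_prop) fun x hx ↦ ?_
    have : 0 < x := hδ.trans_le hx.1
    positivity
  refine h1.congr fun x hx ↦ ?_
  have hx0 : 0 < x := hδ.trans_le hx.1
  rw [eq_div_iff (by positivity), ← hw.flux x ⟨hx0, hx.2⟩]
  ring

lemma green (hw : RadialFlux m w w' g) (hv : RadialFlux m v v' h) {δ : ℝ} (hδ : 0 < δ)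
    (hδ1 : δ ≤ 1) :
    ∫ s in δ..1, g s * v s = δ ^ (m + 2) * w' δ * v δ + ∫ s in δ..1, s ^ (m + 2) * w' s * v' s := by
  rw [integral_mul_eq_sub_integral_primitive_mul hδ hδ1 hw.intervalIntegrable
    (fun r hr ↦ hv.hasDerivAt r ⟨hδ.trans_le hr.1, hr.2⟩) (hv.continuousOn_deriv hδ),
    hw.integral_eq_zero, hw.flux δ ⟨hδ, hδ1⟩]
  have : ∫ s in δ..1, (∫ t in (0:ℝ)..s, g t) * v' s
      = ∫ s in δ..1, -(s ^ (m + 2) * w' s * v' s) := by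
    refine intervalIntegral.integral_congr fun x hx ↦ ?_
    rw [uIcc_of_le hδ1] at hx
    simp only [hw.flux x ⟨hδ.trans_le hx.1, hx.2⟩]
    ring
  rw [this, intervalIntegral.integral_neg]
  ring

lemma tendsto_flux_mul (hw : RadialFlux m w w' g) (hv : ContinuousOn v (Icc 0 1)) :
    Tendsto (fun δ ↦ δ ^ (m + 2) * w' δ * v δ) (nhdsWithin 0 (Ioc 0 1)) (nhds 0) := by
  have h1 : Tendsto (fun δ ↦ -(∫ s in (0:ℝ)..δ, g s) * v δ) (nhdsWithin 0 (Ioc 0 1))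
      (nhds (-(∫ s in (0:ℝ)..0, g s) * v 0)) :=
    ((hw.continuousOn_primitive.neg.mul hv) 0 (by simp)).mono_left
      (nhdsWithin_mono _ Ioc_subset_Icc_self)
  simp only [intervalIntegral.integral_same, neg_zero, zero_mul] at h1
  refine h1.congr' ?_
  filter_upwards [self_mem_nhdsWithin] with δ hδ
  rw [hw.flux δ hδ]

lemma hardy (hw : RadialFlux m w w' g) (hw1 : w 1 = 0) {r : ℝ} (hr : r ∈ Ioc (0:ℝ) 1) :
    r ^ (m + 1) * w r ^ 2 + 1 / 2 * ∫ s in r..1, s ^ m * w s ^ 2 ≤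
      2 * ∫ s in r..1, s ^ (m + 2) * w' s ^ 2 := by
  have hu : uIcc r 1 = Icc r 1 := uIcc_of_le hr.2
  have hcw : ContinuousOn w (Icc r 1) := hw.continuousOn.mono (Icc_subset_Icc_left hr.1.le)
  have hcw' := hw.continuousOn_deriv hr.1
  have hi1 : IntervalIntegrable (fun s ↦ s ^ m * w s ^ 2) volume r 1 := by
    apply ContinuousOn.intervalIntegrable; rw [hu]; fun_prop
  have hi2 : IntervalIntegrable (fun s ↦ s ^ (m + 2) * w' s ^ 2) volume r 1 := by
    apply ContinuousOn.intervalIntegrable; rw [hu]; fun_prop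
  have hi3 : IntervalIntegrable (fun s ↦ ((m + 1 : ℕ) : ℝ) * s ^ m * w s ^ 2
      + s ^ (m + 1) * (2 * w s * w' s)) volume r 1 := by
    apply ContinuousOn.intervalIntegrable; rw [hu]; fun_prop
  have hft := intervalIntegral.integral_eq_sub_of_hasDerivAt
    (f := fun s ↦ s ^ (m + 1) * w s ^ 2)
    (f' := fun s ↦ ((m + 1 : ℕ) : ℝ) * s ^ m * w s ^ 2 + s ^ (m + 1) * (2 * w s * w' s))
    (a := r) (b := 1) (fun s hs ↦ by
      rw [hu] at hs
      have := (hasDerivAt_pow (m + 1) s).fun_mul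
        ((hw.hasDerivAt s ⟨hr.1.trans_le hs.1, hs.2⟩).fun_pow 2)
      simpa using this) hi3
  have hle : ∫ s in r..1, (1 / 2 * (s ^ m * w s ^ 2) - 2 * (s ^ (m + 2) * w' s ^ 2)) ≤
      ∫ s in r..1, (((m + 1 : ℕ) : ℝ) * s ^ m * w s ^ 2 + s ^ (m + 1) * (2 * w s * w' s)) := by
    refine intervalIntegral.integral_mono_on hr.2 ((hi1.const_mul _).sub (hi2.const_mul _)) hi3
      fun s hs ↦ ?_
    have hs0 : 0 < s := hr.1.trans_le hs.1
    have h1 : 0 ≤ s ^ m * (w s + 2 * (s * w' s)) ^ 2 := by positivity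
    have h2 : 0 ≤ (m : ℝ) * (s ^ m * w s ^ 2) := by positivity
    push_cast
    rw [pow_succ s (m + 1), pow_succ s m]
    nlinarith
  rw [intervalIntegral.integral_sub (hi1.const_mul _) (hi2.const_mul _),
    intervalIntegral.integral_const_mul, intervalIntegral.integral_const_mul, hft, hw1] at hle
  simp only [one_pow, ne_eq, OfNat.ofNat_ne_zero, not_false_eq_true, zero_pow, mul_zero,
    zero_sub] at hle
  linarith

lemma abs_le_of_cauchy_data {μ ρ : ℝ} {f : ℝ → ℝ} (hμ : 0 ≤ μ) (hρ : 0 < ρ) (hρ1 : ρ ≤ 1)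
    (hf : IntervalIntegrable f volume 0 1)
    (hw : RadialFlux m w w' (fun s ↦ s ^ (m + 2) * μ * w s + f s)) (hw1 : w 1 = 0)
    {r : ℝ} (hr : r ∈ Icc ρ 1) :
    |w r| ≤ (ρ ^ (m + 2))⁻¹ * Real.exp (μ * (ρ ^ (m + 2))⁻¹) * ∫ s in (0:ℝ)..1, |f s| := by
  set F := ∫ s in (0:ℝ)..1, |f s| with hF
  set A := (ρ ^ (m + 2))⁻¹ with hA
  have hA0 : 0 < A := by positivity
  have hF0 : 0 ≤ F := intervalIntegral.integral_nonneg zero_le_one fun _ _ ↦ abs_nonneg _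
  have hcw (x : ℝ) (hx : 0 ≤ x) : ContinuousOn w (Icc x 1) :=
    hw.continuousOn.mono (Icc_subset_Icc_left hx)
  have hiw (x : ℝ) (hx : x ∈ Icc ρ 1) : IntervalIntegrable (fun s ↦ |w s|) volume x 1 := by
    apply ContinuousOn.intervalIntegrable
    rw [uIcc_of_le hx.2]
    exact (hcw x (hρ.le.trans hx.1)).abs
  have hM0 (x : ℝ) (hx : x ∈ Icc ρ 1) : 0 ≤ ∫ s in x..1, |w s| :=
    intervalIntegral.integral_nonneg hx.2 fun _ _ ↦ abs_nonneg _
  have hif (x : ℝ) (hx : x ∈ Icc ρ 1) : IntervalIntegrable f volume x 1 := by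
    refine hf.mono_set ?_
    rw [uIcc_of_le hx.2, uIcc_of_le zero_le_one]
    exact Icc_subset_Icc_left (hρ.le.trans hx.1)
  have hMmono (x y : ℝ) (hx : x ∈ Icc ρ 1) (hy : y ∈ Icc ρ 1) (hxy : x ≤ y) :
      ∫ s in y..1, |w s| ≤ ∫ s in x..1, |w s| :=
    intervalIntegral.integral_mono_interval hxy hy.2 le_rfl
      (Filter.Eventually.of_forall fun _ ↦ abs_nonneg _) (hiw x hx)
  have hW (x : ℝ) (hx : x ∈ Icc ρ 1) : |w' x| ≤ A * (F + μ * ∫ s in x..1, |w s|) := by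
    have hx0 : 0 < x := hρ.trans_le hx.1
    have h1 : x ^ (m + 2) * w' x = ∫ s in x..1, (s ^ (m + 2) * μ * w s + f s) := by
      have hs : x ∈ Icc (0:ℝ) 1 := ⟨hx0.le, hx.2⟩
      have := intervalIntegral.integral_add_adjacent_intervals
        (hw.intervalIntegrable.mono_set (c := 0) (d := x) ?_)
        (hw.intervalIntegrable.mono_set (c := x) (d := 1) ?_)
      · rw [hw.flux x ⟨hx0, hx.2⟩]
        linarith [hw.integral_eq_zero]
      · exact uIcc_subset_uIcc (by simp) (by rwa [uIcc_of_le zero_le_one])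
      · exact uIcc_subset_uIcc (by rwa [uIcc_of_le zero_le_one]) (by simp)
    have h2 : |x ^ (m + 2) * w' x| ≤ F + μ * ∫ s in x..1, |w s| := by
      rw [h1]
      calc |∫ s in x..1, (s ^ (m + 2) * μ * w s + f s)|
          ≤ ∫ s in x..1, |s ^ (m + 2) * μ * w s + f s| :=
            intervalIntegral.abs_integral_le_integral_abs hx.2
        _ ≤ ∫ s in x..1, (μ * |w s| + |f s|) := by
            refine intervalIntegral.integral_mono_on hx.2 ?_
              (((hiw x hx).const_mul μ).add (hif x hx).abs) fun s hs ↦ ?_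
            · refine (hw.intervalIntegrable.mono_set ?_).abs
              rw [uIcc_of_le hx.2, uIcc_of_le zero_le_one]
              exact Icc_subset_Icc_left hx0.le
            · refine (abs_add_le _ _).trans ?_
              have hs0 : 0 ≤ s := hx0.le.trans hs.1
              have : |s ^ (m + 2) * μ * w s| ≤ μ * |w s| := by
                rw [abs_mul, abs_of_nonneg (by positivity)]
                have : s ^ (m + 2) ≤ 1 := pow_le_one₀ hs0 hs.2
                gcongr
                nlinarith
              linarith
        _ = (μ * ∫ s in x..1, |w s|) + ∫ s in x..1, |f s| := by
            rw [intervalIntegral.integral_add ((hiw x hx).const_mul μ) (hif x hx).abs,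
              intervalIntegral.integral_const_mul]
        _ ≤ F + μ * ∫ s in x..1, |w s| := by
            have : ∫ s in x..1, |f s| ≤ F :=
              intervalIntegral.integral_mono_interval hx0.le hx.2 le_rfl
                (Filter.Eventually.of_forall fun _ ↦ abs_nonneg _) hf.abs
            linarith
    rw [abs_mul, abs_of_pos (by positivity)] at h2
    rw [hA, inv_mul_eq_div, le_div_iff₀ (by positivity), mul_comm]
    exact (mul_le_mul_of_nonneg_right (by gcongr; exact hx.1) (abs_nonneg _)).trans h2
  have hb (x : ℝ) (hx : x ∈ Icc ρ 1) : |w x| ≤ A * (F + μ * ∫ s in x..1, |w s|) := by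
    have h3 := (convex_Icc x 1).norm_image_sub_le_of_norm_hasDerivWithin_le (f := w) (f' := w')
      (C := A * (F + μ * ∫ s in x..1, |w s|)) (x := x) (y := 1)
      (fun y hy ↦ (hw.hasDerivAt y ⟨hρ.trans_le (hx.1.trans hy.1), hy.2⟩).hasDerivWithinAt)
      (fun y hy ↦ (hW y ⟨hx.1.trans hy.1, hy.2⟩).trans (by
        have := hMmono x y hx ⟨hx.1.trans hy.1, hy.2⟩ hy.1
        gcongr))
      ⟨le_rfl, hx.2⟩ ⟨hx.2, le_rfl⟩
    rw [hw1, zero_sub, norm_neg, Real.norm_eq_abs, Real.norm_eq_abs,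
      abs_of_nonneg (a := 1 - x) (by linarith [hx.2])] at h3
    refine h3.trans (mul_le_of_le_one_right ?_ (by linarith [hx.1]))
    have := hM0 x hx
    positivity
  have hmono : MonotoneOn (fun x ↦ (F + μ * ∫ s in x..1, |w s|) * Real.exp (μ * A * x))
      (Icc ρ 1) := by
    have hd (x : ℝ) (hx : x ∈ Ioo ρ 1) : HasDerivAt
        (fun x ↦ (F + μ * ∫ s in x..1, |w s|) * Real.exp (μ * A * x))
        ((μ * -|w x|) * Real.exp (μ * A * x)
          + (F + μ * ∫ s in x..1, |w s|) * (Real.exp (μ * A * x) * (μ * A * 1))) x := by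
      have hx' : x ∈ Ioc (0:ℝ) 1 := ⟨hρ.trans hx.1, hx.2.le⟩
      refine HasDerivAt.fun_mul (HasDerivAt.const_add _ (HasDerivAt.const_mul _ ?_))
        (((hasDerivAt_id x).const_mul _).exp)
      refine intervalIntegral.integral_hasDerivAt_left (hiw x ⟨hx.1.le, hx.2.le⟩) ?_
        (hw.hasDerivAt x hx').continuousAt.abs
      exact ContinuousOn.stronglyMeasurableAtFilter isOpen_Ioo
        ((hcw ρ hρ.le).abs.mono Ioo_subset_Icc_self) x hx
    refine monotoneOn_of_hasDerivWithinAt_nonneg (convex_Icc ρ 1) ?_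
      (fun x hx ↦ (hd x (by rwa [interior_Icc] at hx)).hasDerivWithinAt) fun x hx ↦ ?_
    · refine (continuousOn_const.add (continuousOn_const.mul ?_)).mul (by fun_prop)
      have := intervalIntegral.continuousOn_primitive_interval_left
        (f := fun s ↦ |w s|) (a := ρ) (b := 1) (μ := volume) ?_
      · rwa [uIcc_of_le hρ1] at this
      · rw [uIcc_of_le hρ1]
        exact (hcw ρ hρ.le).abs.integrableOn_Icc
    · rw [interior_Icc] at hx
      have := hb x ⟨hx.1.le, hx.2.le⟩
      have h5 : 0 ≤ μ * Real.exp (μ * A * x) * (A * (F + μ * ∫ s in x..1, |w s|) - |w x|) :=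
        mul_nonneg (by positivity) (by linarith)
      linarith
  have h6 := hmono hr ⟨hρ1, le_rfl⟩ hr.2
  simp only [intervalIntegral.integral_same, mul_zero, add_zero, mul_one] at h6
  have h7 : F + μ * ∫ s in r..1, |w s| ≤ F * Real.exp (μ * A) := by
    refine le_trans (le_mul_of_one_le_right ?_ ?_) h6
    · have := hM0 r hr
      positivity
    · rw [Real.one_le_exp_iff]
      have : 0 < r := hρ.trans_le hr.1
      positivity
  calc |w r| ≤ A * (F + μ * ∫ s in r..1, |w s|) := hb r hr
    _ ≤ A * (F * Real.exp (μ * A)) := by gcongr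
    _ = _ := by ring

lemma energy_le {μ ρ δ : ℝ} {f : ℝ → ℝ} (hμ : 0 ≤ μ) (hδ : 0 < δ) (hδρ : δ ≤ ρ) (hρ1 : ρ ≤ 1)
    (hμρ : 16 * μ * ρ ^ 2 ≤ 1) (hf : IntervalIntegrable f volume 0 1)
    (hw : RadialFlux m w w' (fun s ↦ s ^ (m + 2) * μ * w s + f s)) (hw1 : w 1 = 0) :
    3 / 4 * ∫ s in δ..1, s ^ (m + 2) * w' s ^ 2 ≤
      -(δ ^ (m + 2) * w' δ * w δ) + (∫ s in δ..1, f s * w s) +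
      μ * ((ρ ^ (m + 2))⁻¹ * Real.exp (μ * (ρ ^ (m + 2))⁻¹) * ∫ s in (0:ℝ)..1, |f s|) ^ 2 := by
  have hδ1 := hδρ.trans hρ1
  have hρ := hδ.trans_le hδρ
  have hu : uIcc δ 1 = Icc δ 1 := uIcc_of_le hδ1
  have hcw : ContinuousOn w (Icc δ 1) := hw.continuousOn.mono (Icc_subset_Icc_left hδ.le)
  set S := (ρ ^ (m + 2))⁻¹ * Real.exp (μ * (ρ ^ (m + 2))⁻¹) * ∫ s in (0:ℝ)..1, |f s|
  have hi1 : IntervalIntegrable (fun s ↦ s ^ (m + 2) * w s ^ 2) volume δ 1 := by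
    apply ContinuousOn.intervalIntegrable; rw [hu]; fun_prop
  have hi2 : IntervalIntegrable (fun s ↦ s ^ m * w s ^ 2) volume δ 1 := by
    apply ContinuousOn.intervalIntegrable; rw [hu]; fun_prop
  have hif : IntervalIntegrable (fun s ↦ f s * w s) volume δ 1 := by
    refine (hf.mono_set ?_).mul_continuousOn (by rwa [hu])
    rw [hu, uIcc_of_le zero_le_one]
    exact Icc_subset_Icc_left hδ.le
  have hg := hw.green hw hδ hδ1
  have h1 : ∫ s in δ..1, (s ^ (m + 2) * μ * w s + f s) * w s
      = μ * (∫ s in δ..1, s ^ (m + 2) * w s ^ 2) + ∫ s in δ..1, f s * w s := by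
    rw [← intervalIntegral.integral_const_mul, ← intervalIntegral.integral_add
      (hi1.const_mul _) hif]
    exact intervalIntegral.integral_congr fun s _ ↦ by ring
  have h2 : ∫ s in δ..1, s ^ (m + 2) * w' s * w' s = ∫ s in δ..1, s ^ (m + 2) * w' s ^ 2 :=
    intervalIntegral.integral_congr fun s _ ↦ by ring
  have h3 : ∫ s in δ..1, s ^ (m + 2) * w s ^ 2 ≤
      ∫ s in δ..1, (ρ ^ 2 * (s ^ m * w s ^ 2) + S ^ 2) := by
    refine intervalIntegral.integral_mono_on hδ1 hi1
      ((hi2.const_mul _).add intervalIntegrable_const) fun s hs ↦ ?_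
    have hs0 : 0 < s := hδ.trans_le hs.1
    rcases le_total s ρ with hsρ | hsρ
    · have : s ^ (m + 2) * w s ^ 2 ≤ ρ ^ 2 * (s ^ m * w s ^ 2) := by
        rw [pow_add, mul_comm (s ^ m), mul_assoc]
        gcongr
      nlinarith [sq_nonneg S]
    · have h4 := hw.abs_le_of_cauchy_data hμ hρ hρ1 hf hw1 ⟨hsρ, hs.2⟩
      have h5 : w s ^ 2 ≤ S ^ 2 := sq_le_sq' (by linarith [neg_abs_le (w s)])
        ((le_abs_self _).trans h4)
      have h6 : s ^ (m + 2) * w s ^ 2 ≤ 1 * w s ^ 2 := by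
        gcongr
        exact pow_le_one₀ hs0.le hs.2
      have : 0 ≤ ρ ^ 2 * (s ^ m * w s ^ 2) := by positivity
      linarith
  rw [intervalIntegral.integral_add (hi2.const_mul _) intervalIntegrable_const,
    intervalIntegral.integral_const_mul, intervalIntegral.integral_const, smul_eq_mul] at h3
  have h4 : (∫ s in δ..1, s ^ m * w s ^ 2) ≤ 4 * ∫ s in δ..1, s ^ (m + 2) * w' s ^ 2 := by
    have := hw.hardy hw1 ⟨hδ, hδ1⟩
    have h5 : 0 ≤ δ ^ (m + 1) * w δ ^ 2 := by positivity
    linarith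
  set D := ∫ s in δ..1, s ^ (m + 2) * w' s ^ 2
  have hD : 0 ≤ D := intervalIntegral.integral_nonneg hδ1 fun s hs ↦ by
    have : 0 < s := hδ.trans_le hs.1
    positivity
  have h5 : μ * (∫ s in δ..1, s ^ (m + 2) * w s ^ 2) ≤ 1 / 4 * D + μ * S ^ 2 := by
    calc μ * (∫ s in δ..1, s ^ (m + 2) * w s ^ 2) ≤ μ * (ρ ^ 2 * (4 * D) + 1 * S ^ 2) := by
          refine mul_le_mul_of_nonneg_left (h3.trans ?_) hμ
          gcongr
          linarith
      _ = (16 * μ * ρ ^ 2) * (1 / 4 * D) + μ * S ^ 2 := by ring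
      _ ≤ 1 * (1 / 4 * D) + μ * S ^ 2 := by gcongr
      _ = _ := by ring
  linarith

lemma eq_zero_of_tendsto (hw : RadialFlux m w w' g) (hw1 : w 1 = 0) {E : ℝ → ℝ}
    (hE : Tendsto E (nhdsWithin 0 (Ioc 0 1)) (nhds 0))
    (h : ∀ᶠ δ in nhdsWithin 0 (Ioc 0 1), ∫ s in δ..1, s ^ (m + 2) * w' s ^ 2 ≤ E δ) :
    ∀ r ∈ Ioc (0:ℝ) 1, w r = 0 := by
  intro r hr
  have hne : (nhdsWithin (0:ℝ) (Ioc 0 1)).NeBot := by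
    rw [nhdsWithin_Ioc_eq_nhdsGT one_pos]; infer_instance
  have h1 : r ^ (m + 1) * w r ^ 2 ≤ 2 * 0 := by
    refine ge_of_tendsto (hE.const_mul 2) ?_
    have hlt : ∀ᶠ δ in nhdsWithin (0:ℝ) (Ioc 0 1), δ < r :=
      nhdsWithin_le_nhds (Iio_mem_nhds hr.1)
    filter_upwards [h, hlt, self_mem_nhdsWithin] with δ hδ hδr hδ0
    have h2 := hw.hardy hw1 hr
    have h3 : 0 ≤ ∫ s in r..1, s ^ m * w s ^ 2 :=
      intervalIntegral.integral_nonneg hr.2 fun s hs ↦ by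
        have : 0 < s := hr.1.trans_le hs.1
        positivity
    have h4 : ∫ s in r..1, s ^ (m + 2) * w' s ^ 2 ≤ ∫ s in δ..1, s ^ (m + 2) * w' s ^ 2 := by
      refine intervalIntegral.integral_mono_interval hδr.le hr.2 le_rfl ?_ ?_
      · filter_upwards [ae_restrict_mem measurableSet_Ioc] with s hs
        have : 0 < s := hδ0.1.trans hs.1
        simp only [Pi.zero_apply]
        positivity
      · apply ContinuousOn.intervalIntegrable
        rw [uIcc_of_le hδ0.2]
        have := hw.continuousOn_deriv hδ0.1
        fun_prop
    linarith
  have h5 : 0 < r ^ (m + 1) := pow_pos hr.1 _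
  have h6 : w r ^ 2 ≤ 0 := by
    by_contra! h7
    nlinarith [mul_pos h5 h7]
  nlinarith [sq_nonneg (w r), pow_eq_zero_iff (two_ne_zero) |>.1 (le_antisymm h6 (sq_nonneg _))]

lemma exists_radius {μ : ℝ} (hμ : 0 ≤ μ) : ∃ ρ : ℝ, 0 < ρ ∧ ρ ≤ 1 ∧ 16 * μ * ρ ^ 2 ≤ 1 := by
  refine ⟨1 / (4 * (1 + μ)), by positivity, ?_, ?_⟩
  · rw [div_le_one (by positivity)]; linarith
  · rw [div_pow, one_pow, mul_one_div, div_le_one (by positivity)]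
    nlinarith

lemma eventually_mem_Ioc {ρ : ℝ} (hρ : 0 < ρ) :
    ∀ᶠ δ in nhdsWithin (0:ℝ) (Ioc 0 1), 0 < δ ∧ δ ≤ ρ ∧ δ ≤ 1 := by
  filter_upwards [self_mem_nhdsWithin, nhdsWithin_le_nhds (Iic_mem_nhds hρ)] with δ h1 h2
  exact ⟨h1.1, h2, h1.2⟩

lemma eq_zero_of_cauchy_data {μ : ℝ} (hμ : 0 ≤ μ)
    (hw : RadialFlux m w w' (fun s ↦ s ^ (m + 2) * μ * w s)) (hw1 : w 1 = 0) :
    ∀ r ∈ Ioc (0:ℝ) 1, w r = 0 := by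
  obtain ⟨ρ, hρ, hρ1, hμρ⟩ := exists_radius hμ
  have hE := ((hw.tendsto_flux_mul hw.continuousOn).neg.const_mul (4 / 3))
  rw [neg_zero, mul_zero] at hE
  refine hw.eq_zero_of_tendsto hw1 hE ?_
  filter_upwards [eventually_mem_Ioc hρ] with δ hδ
  have := energy_le (f := fun _ ↦ 0) hμ hδ.1 hδ.2.1 hρ1 hμρ (by simp) (by simpa using hw) hw1
  simp at this
  linarith

end RadialFlux

lemma tendsto_integral_left {f : ℝ → ℝ} (hf : IntervalIntegrable f volume 0 1) :
    Tendsto (fun δ ↦ ∫ s in δ..1, f s) (nhdsWithin 0 (Ioc 0 1)) (nhds (∫ s in (0:ℝ)..1, f s)) := by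
  have h1 := (intervalIntegral.continuousOn_primitive_interval_left
    (f := f) (a := 0) (b := 1) (μ := volume) (by
      rw [uIcc_of_le zero_le_one, integrableOn_Icc_iff_integrableOn_Ioc]
      exact (intervalIntegrable_iff_integrableOn_Ioc_of_le zero_le_one).1 hf)) 0 (by simp)
  rw [uIcc_of_le zero_le_one] at h1
  exact h1.mono_left (nhdsWithin_mono _ Ioc_subset_Icc_self)

/-- Splitting a potential at the critical level `η x⁻²`. -/
lemma mul_sq_le_add_rpow {m : ℕ} {x b η : ℝ} (hx : 0 < x) (hb : 0 ≤ b) (hη : 0 < η) :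
    b * x ^ 2 ≤ η + η ^ (1 - ((m + 3 : ℕ) : ℝ) / 2) *
      (b ^ (((m + 3 : ℕ) : ℝ) / 2) * x ^ (m + 3)) := by
  set p : ℝ := ((m + 3 : ℕ) : ℝ) / 2 with hp
  have hp1 : 1 ≤ p := by
    rw [hp]; push_cast
    have : (0:ℝ) ≤ m := by positivity
    linarith
  have hy : b * x ^ 2 / η ≤ 1 + (b * x ^ 2 / η) ^ p := by
    have hy0 : 0 ≤ b * x ^ 2 / η := by positivity
    rcases le_total (b * x ^ 2 / η) 1 with h | h
    · have := Real.rpow_nonneg hy0 p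
      linarith
    · have := Real.rpow_le_rpow_of_exponent_le h hp1
      rw [Real.rpow_one] at this
      linarith
  have hxp : (x ^ 2) ^ p = x ^ (m + 3) := by
    rw [← Real.rpow_natCast x 2, ← Real.rpow_mul hx.le, ← Real.rpow_natCast x (m + 3), hp]
    congr 1
    push_cast; ring
  rw [Real.div_rpow (by positivity) hη.le, Real.mul_rpow hb (by positivity), hxp,
    div_le_iff₀ hη] at hy
  rw [Real.rpow_sub hη, Real.rpow_one]
  calc b * x ^ 2 ≤ _ := hy
    _ = _ := by ring

lemma integral_pow_mul_le {m : ℕ} {q : ℝ → ℝ} {η : ℝ} (hη : 0 < η) (hq : ∀ s, 0 ≤ q s)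
    (hi : IntervalIntegrable (fun s ↦ s ^ (m + 2) * q s) volume 0 1)
    (hip : IntervalIntegrable (fun s ↦ s ^ (m + 2) * q s ^ (((m + 3 : ℕ) : ℝ) / 2)) volume 0 1) :
    ∫ s in (0:ℝ)..1, s ^ (m + 2) * q s ≤
      η + η ^ (1 - ((m + 3 : ℕ) : ℝ) / 2) *
        ∫ s in (0:ℝ)..1, s ^ (m + 2) * q s ^ (((m + 3 : ℕ) : ℝ) / 2) := by
  set p : ℝ := ((m + 3 : ℕ) : ℝ) / 2
  have h1 : ∫ s in (0:ℝ)..1, s ^ (m + 2) * q s ≤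
      ∫ s in (0:ℝ)..1, (η + η ^ (1 - p) * (s ^ (m + 2) * q s ^ p)) := by
    refine intervalIntegral.integral_mono_on_of_le_Ioo zero_le_one hi
      (intervalIntegrable_const.add (hip.const_mul _)) fun s hs ↦ ?_
    have h2 := mul_le_mul_of_nonneg_left (mul_sq_le_add_rpow (m := m) hs.1 (hq s) hη)
      (pow_nonneg hs.1.le m)
    have hsm : s ^ m ≤ 1 := pow_le_one₀ hs.1.le hs.2.le
    have hsm1 : s ^ (m + 1) ≤ 1 := pow_le_one₀ hs.1.le hs.2.le
    have h3 : 0 ≤ η ^ (1 - p) * (s ^ (m + 2) * q s ^ p) := by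
      have := hq s
      have := hs.1
      positivity
    calc s ^ (m + 2) * q s = s ^ m * (q s * s ^ 2) := by ring
      _ ≤ s ^ m * (η + η ^ (1 - p) * (q s ^ p * s ^ (m + 3))) := h2
      _ = s ^ m * η + s ^ (m + 1) * (η ^ (1 - p) * (s ^ (m + 2) * q s ^ p)) := by ring
      _ ≤ 1 * η + 1 * (η ^ (1 - p) * (s ^ (m + 2) * q s ^ p)) := by gcongr
      _ = _ := by ring
  refine h1.trans_eq ?_
  rw [intervalIntegral.integral_add intervalIntegrable_const (hip.const_mul _),
    intervalIntegral.integral_const_mul]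
  simp

lemma RadialFlux.integral_pow_mul_sq_le {m : ℕ} {w w' g q : ℝ → ℝ} {η δ : ℝ} (hη : 0 < η)
    (hq : ∀ s, 0 ≤ q s) (hw : RadialFlux m w w' g) (hw1 : w 1 = 0) (hδ : 0 < δ) (hδ1 : δ ≤ 1)
    (hi : IntervalIntegrable (fun s ↦ s ^ (m + 2) * q s) volume 0 1)
    (hip : IntervalIntegrable (fun s ↦ s ^ (m + 2) * q s ^ (((m + 3 : ℕ) : ℝ) / 2)) volume 0 1) :
    ∫ s in δ..1, s ^ (m + 2) * q s * w s ^ 2 ≤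
      (4 * η + 2 * (η ^ (1 - ((m + 3 : ℕ) : ℝ) / 2) *
        ∫ s in (0:ℝ)..1, s ^ (m + 2) * q s ^ (((m + 3 : ℕ) : ℝ) / 2))) *
        ∫ s in δ..1, s ^ (m + 2) * w' s ^ 2 := by
  set p : ℝ := ((m + 3 : ℕ) : ℝ) / 2
  have hu : uIcc δ 1 = Icc δ 1 := uIcc_of_le hδ1
  have hsub : uIcc δ 1 ⊆ uIcc (0:ℝ) 1 := by
    rw [hu, uIcc_of_le zero_le_one]
    exact Icc_subset_Icc_left hδ.le
  have hcw : ContinuousOn w (Icc δ 1) := hw.continuousOn.mono (Icc_subset_Icc_left hδ.le)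
  have hcw' := hw.continuousOn_deriv hδ
  have hi1 : IntervalIntegrable (fun s ↦ s ^ m * w s ^ 2) volume δ 1 := by
    apply ContinuousOn.intervalIntegrable; rw [hu]; fun_prop
  have hi2 : IntervalIntegrable (fun s ↦ s ^ (m + 2) * w' s ^ 2) volume δ 1 := by
    apply ContinuousOn.intervalIntegrable; rw [hu]; fun_prop
  have hiq : IntervalIntegrable (fun s ↦ s ^ (m + 2) * q s * w s ^ 2) volume δ 1 :=
    (hi.mono_set hsub).mul_continuousOn (by rw [hu]; fun_prop)
  have hipδ := hip.mono_set hsub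
  set D := ∫ s in δ..1, s ^ (m + 2) * w' s ^ 2
  have hD : 0 ≤ D := intervalIntegral.integral_nonneg hδ1 fun s hs ↦ by
    have : 0 < s := hδ.trans_le hs.1
    positivity
  have hpt (s : ℝ) (hs : s ∈ Icc δ 1) : s ^ (m + 1) * w s ^ 2 ≤ 2 * D := by
    have hs0 : 0 < s := hδ.trans_le hs.1
    have h1 := hw.hardy hw1 ⟨hs0, hs.2⟩
    have h2 : 0 ≤ ∫ t in s..1, t ^ m * w t ^ 2 :=
      intervalIntegral.integral_nonneg hs.2 fun t ht ↦ by
        have : 0 < t := hs0.trans_le ht.1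
        positivity
    have h3 : ∫ t in s..1, t ^ (m + 2) * w' t ^ 2 ≤ D := by
      refine intervalIntegral.integral_mono_interval hs.1 hs.2 le_rfl ?_ hi2
      filter_upwards [ae_restrict_mem measurableSet_Ioc] with t ht
      have : 0 < t := hδ.trans ht.1
      simp only [Pi.zero_apply]
      positivity
    linarith
  have h4 : (∫ s in δ..1, s ^ m * w s ^ 2) ≤ 4 * D := by
    have := hw.hardy hw1 ⟨hδ, hδ1⟩
    have h5 : 0 ≤ δ ^ (m + 1) * w δ ^ 2 := by positivity
    linarith
  have h5 : ∫ s in δ..1, s ^ (m + 2) * q s ^ p ≤ ∫ s in (0:ℝ)..1, s ^ (m + 2) * q s ^ p := by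
    refine intervalIntegral.integral_mono_interval hδ.le hδ1 le_rfl ?_ hip
    filter_upwards [ae_restrict_mem measurableSet_Ioc] with s hs
    have h1 := hs.1
    have h2 := hq s
    simp only [Pi.zero_apply]
    positivity
  have h6 : ∫ s in δ..1, s ^ (m + 2) * q s * w s ^ 2 ≤
      ∫ s in δ..1, (η * (s ^ m * w s ^ 2) + η ^ (1 - p) * (2 * D) * (s ^ (m + 2) * q s ^ p)) := by
    refine intervalIntegral.integral_mono_on hδ1 hiq
      ((hi1.const_mul _).add (hipδ.const_mul _)) fun s hs ↦ ?_
    have hs0 : 0 < s := hδ.trans_le hs.1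
    have hqs := hq s
    have h2 := mul_le_mul_of_nonneg_left (mul_sq_le_add_rpow (m := m) hs0 (hq s) hη)
      (show 0 ≤ s ^ m * w s ^ 2 by positivity)
    have h3 : 0 ≤ η ^ (1 - p) * (s ^ (m + 2) * q s ^ p) := by positivity
    calc s ^ (m + 2) * q s * w s ^ 2 = s ^ m * w s ^ 2 * (q s * s ^ 2) := by ring
      _ ≤ s ^ m * w s ^ 2 * (η + η ^ (1 - p) * (q s ^ p * s ^ (m + 3))) := h2
      _ = η * (s ^ m * w s ^ 2)
          + (s ^ (m + 1) * w s ^ 2) * (η ^ (1 - p) * (s ^ (m + 2) * q s ^ p)) := by ring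
      _ ≤ η * (s ^ m * w s ^ 2) + (2 * D) * (η ^ (1 - p) * (s ^ (m + 2) * q s ^ p)) := by
          have := mul_le_mul_of_nonneg_right (hpt s hs) h3
          linarith
      _ = _ := by ring
  rw [intervalIntegral.integral_add (hi1.const_mul _) (hipδ.const_mul _),
    intervalIntegral.integral_const_mul, intervalIntegral.integral_const_mul] at h6
  calc _ ≤ _ := h6
    _ ≤ η * (4 * D) + η ^ (1 - p) * (2 * D) * ∫ s in (0:ℝ)..1, s ^ (m + 2) * q s ^ p := by
        gcongr
    _ = _ := by ring

lemma sq_integral_mul_le {q u : ℝ → ℝ} (hq : ∀ s ∈ Icc (0:ℝ) 1, 0 ≤ q s)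
    (hi : IntervalIntegrable q volume 0 1) (hu : ContinuousOn u (Icc 0 1)) :
    (∫ s in (0:ℝ)..1, q s * |u s|) ^ 2 ≤
      (∫ s in (0:ℝ)..1, q s * u s ^ 2) * ∫ s in (0:ℝ)..1, q s := by
  have hu' : ContinuousOn u (uIcc 0 1) := by rwa [uIcc_of_le zero_le_one]
  have hi1 : IntervalIntegrable (fun s ↦ q s * |u s|) volume 0 1 := hi.mul_continuousOn hu'.abs
  have hi2 : IntervalIntegrable (fun s ↦ q s * u s ^ 2) volume 0 1 :=
    hi.mul_continuousOn (hu'.pow 2)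
  have h := discrim_le_zero (a := ∫ s in (0:ℝ)..1, q s * u s ^ 2)
    (b := -2 * ∫ s in (0:ℝ)..1, q s * |u s|) (c := ∫ s in (0:ℝ)..1, q s) fun x ↦ by
    have h1 : 0 ≤ ∫ s in (0:ℝ)..1, q s * (x * |u s| - 1) ^ 2 :=
      intervalIntegral.integral_nonneg zero_le_one fun s hs ↦ mul_nonneg (hq s hs) (sq_nonneg _)
    have h2 : ∫ s in (0:ℝ)..1, q s * (x * |u s| - 1) ^ 2 =
        ∫ s in (0:ℝ)..1, ((q s * u s ^ 2) * (x * x) - (q s * |u s|) * (2 * x) + q s) :=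
      intervalIntegral.integral_congr fun s _ ↦ by
        rw [← sq_abs (u s)]
        ring
    rw [h2, intervalIntegral.integral_add ((hi2.mul_const _).sub (hi1.mul_const _)) hi,
      intervalIntegral.integral_sub (hi2.mul_const _) (hi1.mul_const _),
      intervalIntegral.integral_mul_const, intervalIntegral.integral_mul_const] at h1
    linarith
  rw [discrim] at h
  linarith

/-- Rigidity: a nonnegative perturbation `q` of the eigenvalue `μ` that is small in the critical
Lebesgue space can only have solutions proportional to the eigenfunction, and then `q` vanishes
where the solution does not. -/
lemma exists_rigidity_threshold (m : ℕ) {μ : ℝ} (hμ : 0 ≤ μ) :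
    ∃ β₀ : ℝ, 0 < β₀ ∧ ∀ q u u' φ φ' : ℝ → ℝ, (∀ s, 0 ≤ q s) →
      IntervalIntegrable (fun s ↦ s ^ (m + 2) * q s) volume 0 1 →
      IntervalIntegrable (fun s ↦ s ^ (m + 2) * q s ^ (((m + 3 : ℕ) : ℝ) / 2)) volume 0 1 →
      ∫ s in (0:ℝ)..1, s ^ (m + 2) * q s ^ (((m + 3 : ℕ) : ℝ) / 2) < β₀ →
      RadialFlux m u u' (fun s ↦ s ^ (m + 2) * μ * u s + s ^ (m + 2) * q s * u s) →
      RadialFlux m φ φ' (fun s ↦ s ^ (m + 2) * μ * φ s) → φ 1 ≠ 0 →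
      (∃ t, ∀ r ∈ Ioc (0:ℝ) 1, u r = t * φ r) ∧
        ∫ s in (0:ℝ)..1, s ^ (m + 2) * q s * u s ^ 2 = 0 := by
  obtain ⟨ρ, hρ, hρ1, hμρ⟩ := RadialFlux.exists_radius hμ
  set C₁ : ℝ := (ρ ^ (m + 2))⁻¹ * Real.exp (μ * (ρ ^ (m + 2))⁻¹) with hC₁
  set C₂ : ℝ := μ * C₁ ^ 2 + 1 with hC₂
  have hC₂1 : 1 ≤ C₂ := by
    have : 0 ≤ μ * C₁ ^ 2 := by positivity
    linarith
  have hC₂0 : 0 < C₂ := by linarith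
  set η : ℝ := 1 / (16 * C₂) with hη
  have hη0 : 0 < η := by positivity
  set p : ℝ := ((m + 3 : ℕ) : ℝ) / 2
  have hηp : 0 < η ^ (1 - p) := Real.rpow_pos_of_pos hη0 _
  refine ⟨1 / (8 * C₂ * η ^ (1 - p)), by positivity, ?_⟩
  intro q u u' φ φ' hq hiq hiqp hβ hu hφ hφ1
  set β := ∫ s in (0:ℝ)..1, s ^ (m + 2) * q s ^ p
  have hne : (nhdsWithin (0:ℝ) (Ioc 0 1)).NeBot := by
    rw [nhdsWithin_Ioc_eq_nhdsGT one_pos]; infer_instance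
  have hβ0 : 0 ≤ β := intervalIntegral.integral_nonneg zero_le_one fun s hs ↦ by
    have := hs.1
    have := hq s
    positivity
  set ε := 4 * η + 2 * (η ^ (1 - p) * β) with hε
  have hε0 : 0 ≤ ε := by positivity
  have hεC : ε * C₂ ≤ 1 / 2 := by
    rw [lt_div_iff₀ (by positivity)] at hβ
    have h1 : η * C₂ = 1 / 16 := by rw [hη]; field_simp
    nlinarith
  have hε1 : ε ≤ 1 := by nlinarith
  set t := u 1 / φ 1 with ht
  set w : ℝ → ℝ := fun r ↦ u r - t * φ r with hwdef
  set f : ℝ → ℝ := fun s ↦ s ^ (m + 2) * q s * u s with hf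
  have hw : RadialFlux m w (fun r ↦ u' r - t * φ' r) (fun s ↦ s ^ (m + 2) * μ * w s + f s) := by
    have := hu.sub_const_mul hφ t
    convert this using 2 with s
    simp only [hwdef, hf]
    ring
  have hw1 : w 1 = 0 := by simp only [hwdef, ht]; field_simp; ring
  have hI : uIcc (0:ℝ) 1 = Icc 0 1 := uIcc_of_le zero_le_one
  have hmul {v : ℝ → ℝ} (hv : ContinuousOn v (Icc 0 1)) :
      IntervalIntegrable (fun s ↦ s ^ (m + 2) * q s * v s) volume 0 1 :=
    hiq.mul_continuousOn (by rwa [hI])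
  have hif : IntervalIntegrable f volume 0 1 := hmul hu.continuousOn
  have hfmul {v : ℝ → ℝ} (hv : ContinuousOn v (Icc 0 1)) :
      IntervalIntegrable (fun s ↦ f s * v s) volume 0 1 := hif.mul_continuousOn (by rwa [hI])
  have hsub {δ : ℝ} (hδ : 0 < δ) (hδ1 : δ ≤ 1) : uIcc δ 1 ⊆ uIcc (0:ℝ) 1 := by
    rw [hI, uIcc_of_le hδ1]
    exact Icc_subset_Icc_left hδ.le
  have hfφ : ∫ s in (0:ℝ)..1, f s * φ s = 0 := by
    refine tendsto_nhds_unique (tendsto_integral_left (hfmul hφ.continuousOn)) ?_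
    have h1 := (hu.tendsto_flux_mul hφ.continuousOn).sub (hφ.tendsto_flux_mul hu.continuousOn)
    rw [sub_zero] at h1
    refine h1.congr' ?_
    filter_upwards [self_mem_nhdsWithin] with δ hδ
    have h2 := hu.green hφ hδ.1 hδ.2
    have h3 := hφ.green hu hδ.1 hδ.2
    have h4 : ∫ s in δ..1, f s * φ s =
        ∫ s in δ..1, ((s ^ (m + 2) * μ * u s + s ^ (m + 2) * q s * u s) * φ s
          - s ^ (m + 2) * μ * φ s * u s) :=
      intervalIntegral.integral_congr fun s _ ↦ by simp only [hf]; ring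
    have h5 : ∫ s in δ..1, s ^ (m + 2) * u' s * φ' s = ∫ s in δ..1, s ^ (m + 2) * φ' s * u' s :=
      intervalIntegral.integral_congr fun s _ ↦ by ring
    rw [h4, intervalIntegral.integral_sub, h2, h3, h5]
    · ring
    · exact (hu.intervalIntegrable.mul_continuousOn (by rw [hI]; exact hφ.continuousOn)).mono_set
        (hsub hδ.1 hδ.2)
    · exact (hφ.intervalIntegrable.mul_continuousOn (by rw [hI]; exact hu.continuousOn)).mono_set
        (hsub hδ.1 hδ.2)
  set A := ∫ s in (0:ℝ)..1, s ^ (m + 2) * q s * u s ^ 2 with hA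
  set Q := ∫ s in (0:ℝ)..1, s ^ (m + 2) * q s * w s ^ 2 with hQ
  set B := ∫ s in (0:ℝ)..1, s ^ (m + 2) * q s with hB
  set F := ∫ s in (0:ℝ)..1, |f s| with hF
  have hiA : IntervalIntegrable (fun s ↦ s ^ (m + 2) * q s * u s ^ 2) volume 0 1 :=
    hmul (hu.continuousOn.pow 2)
  have hiQ : IntervalIntegrable (fun s ↦ s ^ (m + 2) * q s * w s ^ 2) volume 0 1 :=
    hmul (hw.continuousOn.pow 2)
  have hA0 : 0 ≤ A := intervalIntegral.integral_nonneg zero_le_one fun s hs ↦ by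
    have := hs.1
    have := hq s
    positivity
  have hB0 : 0 ≤ B := intervalIntegral.integral_nonneg zero_le_one fun s hs ↦ by
    have := hs.1
    have := hq s
    positivity
  have hfw : ∫ s in (0:ℝ)..1, f s * w s = A := by
    have h1 : ∫ s in (0:ℝ)..1, f s * w s =
        ∫ s in (0:ℝ)..1, (s ^ (m + 2) * q s * u s ^ 2 - t * (f s * φ s)) :=
      intervalIntegral.integral_congr fun s _ ↦ by simp only [hf, hwdef]; ring
    rw [h1, intervalIntegral.integral_sub hiA ((hfmul hφ.continuousOn).const_mul t),
      intervalIntegral.integral_const_mul, hfφ, mul_zero, sub_zero]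
  have hAQ : A ≤ Q := by
    have h1 : ∫ s in (0:ℝ)..1, f s * w s ≤ ∫ s in (0:ℝ)..1,
        (1 / 2 * (s ^ (m + 2) * q s * u s ^ 2) + 1 / 2 * (s ^ (m + 2) * q s * w s ^ 2)) := by
      refine intervalIntegral.integral_mono_on zero_le_one (hfmul hw.continuousOn)
        ((hiA.const_mul _).add (hiQ.const_mul _)) fun s hs ↦ ?_
      have h2 : 0 ≤ s ^ (m + 2) * q s * (u s - w s) ^ 2 := by
        have := hs.1
        have := hq s
        positivity
      simp only [hf]
      linarith
    rw [intervalIntegral.integral_add (hiA.const_mul _) (hiQ.const_mul _),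
      intervalIntegral.integral_const_mul, intervalIntegral.integral_const_mul, hfw] at h1
    linarith
  have hBε : B ≤ ε := by
    have h1 := integral_pow_mul_le hη0 hq hiq hiqp
    have h2 : 0 ≤ η ^ (1 - p) * β := by positivity
    linarith
  have hFAB : F ^ 2 ≤ A * B := by
    have h1 := sq_integral_mul_le (q := fun s ↦ s ^ (m + 2) * q s) (u := u)
      (fun s hs ↦ mul_nonneg (pow_nonneg hs.1 _) (hq s)) hiq hu.continuousOn
    have h2 : F = ∫ s in (0:ℝ)..1, s ^ (m + 2) * q s * |u s| := by
      refine intervalIntegral.integral_congr fun s hs ↦ ?_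
      rw [hI] at hs
      simp only [hf]
      rw [abs_mul, abs_of_nonneg (mul_nonneg (pow_nonneg hs.1 _) (hq s))]
    rwa [h2]
  set e : ℝ → ℝ := fun δ ↦ -(δ ^ (m + 2) * (u' δ - t * φ' δ) * w δ) + (∫ s in δ..1, f s * w s)
    + μ * (C₁ * F) ^ 2 with he
  have hten : Tendsto e (nhdsWithin 0 (Ioc 0 1)) (nhds (-0 + A + μ * (C₁ * F) ^ 2)) := by
    rw [← hfw]
    exact ((hw.tendsto_flux_mul hw.continuousOn).neg.add
      (tendsto_integral_left (hfmul hw.continuousOn))).add_const _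
  have hene : ∀ᶠ δ in nhdsWithin (0:ℝ) (Ioc 0 1),
      ∫ s in δ..1, s ^ (m + 2) * (u' s - t * φ' s) ^ 2 ≤ 4 / 3 * e δ := by
    filter_upwards [RadialFlux.eventually_mem_Ioc hρ] with δ hδ
    have := RadialFlux.energy_le hμ hδ.1 hδ.2.1 hρ1 hμρ hif hw hw1
    simp only [he]
    linarith
  have hQle : Q ≤ ε * (4 / 3 * (-0 + A + μ * (C₁ * F) ^ 2)) := by
    refine le_of_tendsto_of_tendsto (tendsto_integral_left hiQ)
      ((hten.const_mul (4 / 3)).const_mul ε) ?_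
    filter_upwards [hene, self_mem_nhdsWithin] with δ hδ hδ0
    exact (hw.integral_pow_mul_sq_le hη0 hq hw1 hδ0.1 hδ0.2 hiq hiqp).trans
      (mul_le_mul_of_nonneg_left hδ hε0)
  have hbound : A + μ * (C₁ * F) ^ 2 ≤ C₂ * Q := by
    have h1 : F ^ 2 ≤ Q := by nlinarith
    have h2 : μ * (C₁ * F) ^ 2 ≤ μ * C₁ ^ 2 * Q := by
      rw [mul_pow, ← mul_assoc]
      gcongr
    rw [hC₂]
    linarith
  have hQ0 : Q ≤ 0 := by
    have hQnn : 0 ≤ Q := hA0.trans hAQ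
    have h1 : ε * (4 / 3 * (-0 + A + μ * (C₁ * F) ^ 2)) ≤ ε * (4 / 3 * (C₂ * Q)) := by
      gcongr
      linarith
    have h2 : ε * C₂ * Q ≤ 1 / 2 * Q := by gcongr
    linarith
  have hAz : A = 0 := le_antisymm (hAQ.trans hQ0) hA0
  have hFz : F = 0 := by
    rw [hAz, zero_mul] at hFAB
    exact pow_eq_zero_iff two_ne_zero |>.1 (le_antisymm hFAB (sq_nonneg _))
  refine ⟨⟨t, fun r hr ↦ ?_⟩, hAz⟩
  have hE := hten.const_mul (4 / 3)
  rw [hAz, hFz] at hE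
  simp only [neg_zero, mul_zero, ne_eq, OfNat.ofNat_ne_zero, not_false_eq_true, zero_pow,
    add_zero] at hE
  have := hw.eq_zero_of_tendsto hw1 hE hene r hr
  simp only [hwdef] at this
  linarith

/-- The profile on `(1/2, 1]` obtained from `cos (ω (r^(-(m+1)) - 1))`, an explicit solution of
`(r^(m+2) v')' + (m+1)² ω² r^(-(m+2)) v = 0`. -/
lemma hasDerivAt_inv_pow_phase (m : ℕ) (ω : ℝ) {r : ℝ} (hr : 0 < r) :
    HasDerivAt (fun x : ℝ ↦ ω * ((x ^ (m + 1))⁻¹ - 1)) (-(ω * (m + 1)) * (r ^ (m + 2))⁻¹) r := by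
  have h := (((hasDerivAt_pow (m + 1) r).inv (pow_ne_zero _ hr.ne')).sub_const 1).const_mul ω
  refine h.congr_deriv ?_
  rw [Nat.add_sub_cancel]
  push_cast
  field_simp
  ring

/-- Shrinking a radial Neumann solution to the half ball and continuing it by an explicit
oscillating profile produces a bounded admissible potential. -/
lemma exists_bounded_potential {m : ℕ} {μ : ℝ} (hμ : 0 ≤ μ) {φ : ℝ → ℝ}
    (hφ : IsRadialNeumannSolution (m + 3) (fun _ ↦ μ) φ) (hφ0 : NontrivialSol φ) :
    ∃ a : ℝ → ℝ, Measurable a ∧ (∃ C, ∀ r, |a r| ≤ C) ∧ Prec μ a ∧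
      ∃ u, IsRadialNeumannSolution (m + 3) a u ∧ NontrivialSol u := by
  obtain ⟨φ', hφc, hφd, hφi, hφn⟩ := hφ
  simp only [Nat.add_succ_sub_one] at hφi
  set T : ℝ := 2 ^ (m + 1) - 1 with hT
  have hT0 : 0 < T := by
    have : (1:ℝ) < 2 ^ (m + 1) := one_lt_pow₀ one_lt_two (Nat.succ_ne_zero m)
    linarith
  obtain ⟨j, hj⟩ := exists_nat_gt ((μ + 1) * T / (2 * Real.pi))
  set ω : ℝ := j * (2 * Real.pi) / T with hω
  have hωμ : μ + 1 < ω := by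
    rw [div_lt_iff₀ (by positivity)] at hj
    rwa [hω, lt_div_iff₀ hT0]
  set K : ℝ := ω * (m + 1) with hK
  have hKω : ω ≤ K := by
    rw [hK]
    exact le_mul_of_one_le_right (by linarith) (by linarith [(m.cast_nonneg : (0:ℝ) ≤ m)])
  have hK2 : μ < K ^ 2 := by nlinarith
  set θ : ℝ → ℝ := fun x ↦ ω * ((x ^ (m + 1))⁻¹ - 1) with hθ
  have hθ1 : θ 1 = 0 := by simp [hθ]
  have hθh : θ (1 / 2) = j * (2 * Real.pi) := by
    simp only [hθ, one_div, inv_pow, inv_inv]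
    rw [← hT, hω]
    field_simp
  have hsin : Real.sin (θ (1 / 2)) = 0 := by
    rw [hθh, ← zero_add ((j:ℝ) * _), Real.sin_add_nat_mul_two_pi, Real.sin_zero]
  have hcos : Real.cos (θ (1 / 2)) = 1 := by rw [hθh, Real.cos_nat_mul_two_pi]
  have hθd {r : ℝ} (hr : 0 < r) : HasDerivAt θ (-K * (r ^ (m + 2))⁻¹) r :=
    hasDerivAt_inv_pow_phase m ω hr
  set v : ℝ → ℝ := fun r ↦ φ 1 * Real.cos (θ r) with hv
  set v' : ℝ → ℝ := fun r ↦ φ 1 * K * Real.sin (θ r) * (r ^ (m + 2))⁻¹ with hv'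
  have hvd {r : ℝ} (hr : 0 < r) : HasDerivAt v (v' r) r := by
    refine ((hθd hr).cos.const_mul (φ 1)).congr_deriv ?_
    simp only [hv']
    ring
  have hvf {r : ℝ} (hr : 0 < r) : HasDerivAt (fun x ↦ -(φ 1 * K * Real.sin (θ x)))
      (r ^ (m + 2) * (K ^ 2 * ((r ^ (m + 2))⁻¹) ^ 2) * v r) r := by
    refine ((hθd hr).sin.const_mul (φ 1 * K)).neg.congr_deriv ?_
    simp only [hv]
    field_simp
  set a : ℝ → ℝ := fun r ↦ if r ≤ 1 / 2 then 4 * μ else K ^ 2 * ((r ^ (m + 2))⁻¹) ^ 2 with ha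
  set u : ℝ → ℝ := fun r ↦ if r ≤ 1 / 2 then φ (2 * r) else v r with hu
  set u' : ℝ → ℝ := fun r ↦ if r ≤ 1 / 2 then φ' (2 * r) * 2 else v' r with hu'
  have ham : Measurable a :=
    Measurable.ite measurableSet_Iic measurable_const (by fun_prop)
  have hab : ∀ r, |a r| ≤ 4 * μ + K ^ 2 * (2 ^ (m + 2)) ^ 2 := fun r ↦ by
    by_cases hr : r ≤ 1 / 2
    · simp only [ha, if_pos hr]
      rw [abs_of_nonneg (by positivity)]
      linarith [show 0 ≤ K ^ 2 * (2 ^ (m + 2)) ^ 2 by positivity]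
    · simp only [ha, if_neg hr]
      rw [not_le] at hr
      have hr0 : 0 < r := by linarith
      rw [abs_of_nonneg (by positivity)]
      have : (r ^ (m + 2))⁻¹ ≤ 2 ^ (m + 2) := by
        rw [← inv_pow]
        exact pow_le_pow_left₀ (by positivity) (by rw [inv_le_comm₀ hr0 two_pos]; linarith) _
      have h2 : K ^ 2 * ((r ^ (m + 2))⁻¹) ^ 2 ≤ K ^ 2 * (2 ^ (m + 2)) ^ 2 := by gcongr
      linarith
  have hgt : ∀ r ∈ Ioo (1 / 2 : ℝ) 1, μ < a r := fun r hr ↦ by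
    have hr0 : 0 < r := by linarith [hr.1]
    simp only [ha, if_neg (not_le.2 hr.1)]
    have h1 : 1 ≤ (r ^ (m + 2))⁻¹ := (one_le_inv₀ (by positivity)).2 (pow_le_one₀ hr0.le hr.2.le)
    have h2 : 1 ≤ ((r ^ (m + 2))⁻¹) ^ 2 := one_le_pow₀ h1
    nlinarith [sq_nonneg K]
  have hul {r : ℝ} (hr : r ≤ 1 / 2) : u r = φ (2 * r) := if_pos hr
  have hur {r : ℝ} (hr : 1 / 2 ≤ r) : u r = v r := by
    rcases hr.eq_or_lt with rfl | hr
    · simp only [hu, hv, le_refl, if_true, hcos]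
      norm_num
    · exact if_neg hr.not_ge
  have hu'r {r : ℝ} (hr : 1 / 2 ≤ r) : u' r = v' r := by
    rcases hr.eq_or_lt with rfl | hr
    · simp only [hu', hv', le_refl, if_true, hsin]
      norm_num [hφn]
    · exact if_neg hr.not_ge
  have hφ2 {r : ℝ} (hr : 0 < r) (hr2 : r ≤ 1 / 2) :
      HasDerivAt (fun x ↦ φ (2 * x)) (φ' (2 * r) * 2) r := by
    have h1 : HasDerivAt (fun x : ℝ ↦ 2 * x) 2 r := by
      simpa using (hasDerivAt_id r).const_mul (2:ℝ)
    exact (hφd (2 * r) ⟨by linarith, by linarith⟩).comp r h1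
  have hud : ∀ r ∈ Ioc (0:ℝ) 1, HasDerivAt u (u' r) r := fun r hr ↦ by
    rcases lt_trichotomy r (1 / 2) with h | h | h
    · have h1 : u' r = φ' (2 * r) * 2 := if_pos h.le
      rw [h1]
      refine (hφ2 hr.1 h.le).congr_of_eventuallyEq ?_
      filter_upwards [Iio_mem_nhds h] with x hx using hul (le_of_lt hx)
    · have h1 : HasDerivWithinAt u (u' r) (Iic r) r := by
        have h2 : u' r = φ' (2 * r) * 2 := if_pos h.le
        rw [h2]
        exact (hφ2 hr.1 h.le).hasDerivWithinAt.congr (fun x hx ↦ hul (hx.trans h.le)) (hul h.le)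
      have h2 : HasDerivWithinAt u (u' r) (Ici r) r := by
        rw [hu'r h.ge]
        exact (hvd hr.1).hasDerivWithinAt.congr (fun x hx ↦ hur (h.ge.trans hx)) (hur h.ge)
      have h3 := h1.union h2
      rwa [Iic_union_Ici, hasDerivWithinAt_univ] at h3
    · rw [hu'r h.le]
      refine (hvd hr.1).congr_of_eventuallyEq ?_
      filter_upwards [Ioi_mem_nhds h] with x hx using hur (le_of_lt hx)
  have huc : ContinuousOn u (Icc 0 1) := fun r hr ↦ by
    rcases hr.1.eq_or_lt with rfl | h
    · have h1 : ContinuousOn (fun x ↦ φ (2 * x)) (Icc 0 (1 / 2)) :=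
        hφc.comp (by fun_prop) fun x hx ↦ ⟨by linarith [hx.1], by linarith [hx.2]⟩
      have h2 : ContinuousWithinAt u (Icc 0 (1 / 2)) 0 :=
        (h1.congr fun x hx ↦ hul hx.2) 0 ⟨le_rfl, by norm_num⟩
      refine h2.mono_of_mem_nhdsWithin ?_
      filter_upwards [self_mem_nhdsWithin, mem_nhdsWithin_of_mem_nhds
        (Iio_mem_nhds (show (0:ℝ) < 1 / 2 by norm_num))] with x hx hx' using ⟨hx.1, le_of_lt hx'⟩
    · exact (hud r ⟨h, hr.2⟩).continuousAt.continuousWithinAt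
  have hflux : IntervalIntegrable (fun s ↦ s ^ (m + 2) * a s * u s) volume 0 1 := by
    have h1 : IntervalIntegrable a volume 0 1 := by
      rw [intervalIntegrable_iff]
      exact Measure.integrableOn_of_bounded (by simp) ham.aestronglyMeasurable
        (ae_of_all _ hab)
    have hc : ContinuousOn u (uIcc 0 1) := by rwa [uIcc_of_le zero_le_one]
    exact (h1.continuousOn_mul (by fun_prop)).mul_continuousOn hc
  have hleft {r : ℝ} (hr : 0 < r) (hr2 : r ≤ 1 / 2) :
      r ^ (m + 2) * (φ' (2 * r) * 2) = - ∫ s in (0:ℝ)..r, s ^ (m + 2) * a s * u s := by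
    have h1 : ∫ s in (0:ℝ)..r, s ^ (m + 2) * a s * u s =
        ∫ s in (0:ℝ)..r, 4 * (2 ^ (m + 2))⁻¹ * ((2 * s) ^ (m + 2) * μ * φ (2 * s)) := by
      refine intervalIntegral.integral_congr fun s hs ↦ ?_
      rw [uIcc_of_le hr.le] at hs
      have hs2 : s ≤ 1 / 2 := hs.2.trans hr2
      have h2 : a s = 4 * μ := if_pos hs2
      simp only [hul hs2, h2, mul_pow]
      field_simp
    rw [h1, intervalIntegral.integral_const_mul,
      intervalIntegral.integral_comp_mul_left (fun x ↦ x ^ (m + 2) * μ * φ x) two_ne_zero,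
      mul_zero, ← neg_neg (∫ x in (0:ℝ)..2 * r, _),
      ← hφi (2 * r) ⟨by linarith, by linarith⟩, mul_pow, smul_eq_mul]
    field_simp
    ring
  have hright {r : ℝ} (hr : 1 / 2 ≤ r) (hr1 : r ≤ 1) :
      r ^ (m + 2) * v' r = - ∫ s in (0:ℝ)..r, s ^ (m + 2) * a s * u s := by
    have hs1 : uIcc 0 (1 / 2) ⊆ uIcc (0:ℝ) 1 := uIcc_subset_uIcc (by simp) (by norm_num [mem_uIcc])
    have hs2 : uIcc (1 / 2) r ⊆ uIcc (0:ℝ) 1 := by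
      rw [uIcc_of_le hr, uIcc_of_le zero_le_one]
      exact Icc_subset_Icc (by norm_num) hr1
    have h0 : ∫ s in (0:ℝ)..(1 / 2), s ^ (m + 2) * a s * u s = 0 := by
      have h := hleft (r := 1 / 2) (by norm_num) le_rfl
      have h2 : φ' (2 * (1 / 2)) = 0 := by norm_num [hφn]
      rw [h2] at h
      linarith
    have h1 : ∫ s in (1 / 2)..r, s ^ (m + 2) * a s * u s =
        ∫ s in (1 / 2)..r, s ^ (m + 2) * (K ^ 2 * ((s ^ (m + 2))⁻¹) ^ 2) * v s := by
      refine intervalIntegral.integral_congr_ae (ae_of_all _ fun s hs ↦ ?_)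
      rw [uIoc_of_le hr] at hs
      have h2 : a s = K ^ 2 * ((s ^ (m + 2))⁻¹) ^ 2 := if_neg hs.1.not_ge
      rw [h2, hur hs.1.le]
    have h2 : ∫ s in (1 / 2)..r, s ^ (m + 2) * (K ^ 2 * ((s ^ (m + 2))⁻¹) ^ 2) * v s =
        -(φ 1 * K * Real.sin (θ r)) - -(φ 1 * K * Real.sin (θ (1 / 2))) := by
      refine intervalIntegral.integral_eq_sub_of_hasDerivAt (fun x hx ↦ hvf ?_) ?_
      · rw [uIcc_of_le hr] at hx
        linarith [hx.1]
      · refine (hflux.mono_set hs2).congr fun s hs ↦ ?_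
        rw [uIoc_of_le hr] at hs
        have h2 : a s = K ^ 2 * ((s ^ (m + 2))⁻¹) ^ 2 := if_neg hs.1.not_ge
        simp only [h2, hur hs.1.le]
    rw [← intervalIntegral.integral_add_adjacent_intervals (hflux.mono_set hs1) (hflux.mono_set hs2),
      h0, h1, h2, hsin]
    have hr0 : 0 < r := by linarith
    simp only [hv']
    field_simp
    ring
  refine ⟨a, ham, ⟨_, hab⟩, ⟨(ae_restrict_iff' measurableSet_Ioo).2 (ae_of_all _ fun r hr ↦ ?_), ?_⟩,
    u, ⟨u', ?_, ?_, ?_, ?_⟩, ?_⟩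
  · by_cases h : r ≤ 1 / 2
    · simp only [ha, if_pos h]
      linarith
    · exact (hgt r ⟨not_le.1 h, hr.2⟩).le
  · refine lt_of_lt_of_le ?_ (measure_mono (s := Ioo (1 / 2 : ℝ) 1) fun r hr ↦
      ⟨⟨by linarith [hr.1], hr.2⟩, hgt r hr⟩)
    rw [Real.volume_Ioo]
    norm_num
  · exact huc
  · exact hud
  · intro r hr
    rcases le_total r (1 / 2) with h | h
    · have h1 : u' r = φ' (2 * r) * 2 := if_pos h
      rw [h1]
      exact hleft hr.1 h
    · rw [hu'r h]
      exact hright h hr.2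
  · simp only [hu', hv', if_neg (show ¬ (1:ℝ) ≤ 1 / 2 by norm_num), hθ1, Real.sin_zero]
    ring
  · obtain ⟨r, hr, hφr⟩ := hφ0
    refine ⟨r / 2, ⟨by linarith [hr.1], by linarith [hr.2]⟩, ?_⟩
    simp only [hu, if_pos (show r / 2 ≤ 1 / 2 by linarith [hr.2])]
    rwa [mul_div_cancel₀ r two_ne_zero]

lemma omegaN_pos {N : ℕ} (hN : 0 < N) : 0 < omegaN N := by
  have : 0 < volume (Metric.ball (0 : EuclideanSpace ℝ (Fin N)) 1) :=
    Metric.measure_ball_pos _ _ one_pos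
  exact mul_pos (by exact_mod_cast hN) (ENNReal.toReal_pos this.ne' measure_ball_lt_top.ne)

lemma RadialMemLp.of_bounded {N : ℕ} {p : ℝ} (hp : 0 ≤ p) {a : ℝ → ℝ} (ha : Measurable a) {C : ℝ}
    (hC : ∀ r, |a r| ≤ C) : RadialMemLp N p a := by
  have hm : Measurable fun r : ℝ ↦ r ^ (N - 1) * |a r| ^ p := by fun_prop
  refine Measure.integrableOn_of_bounded (M := C ^ p) (by simp) hm.aestronglyMeasurable ?_
  refine (ae_restrict_iff' measurableSet_Ioo).2 (ae_of_all _ fun r hr ↦ ?_)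
  have h1 : |a r| ^ p ≤ C ^ p := Real.rpow_le_rpow (abs_nonneg _) (hC r) hp
  have h2 : r ^ (N - 1) ≤ 1 := pow_le_one₀ hr.1.le hr.2.le
  have h3 : 0 ≤ r ^ (N - 1) := pow_nonneg hr.1.le _
  have h4 : 0 ≤ |a r| ^ p := by positivity
  rw [Real.norm_of_nonneg (by positivity)]
  nlinarith

/-- A function dominated by a radial `L^p` function, `1 ≤ p`, is integrable on the unit ball together
with its `p`-th power. -/
lemma RadialMemLp.intervalIntegrable_of_le {m : ℕ} {p : ℝ} (hp : 1 ≤ p) {a q : ℝ → ℝ}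
    (ha : RadialMemLp (m + 3) p a) (hq : Measurable q) (hq0 : ∀ s, 0 ≤ q s)
    (hqa : ∀ᵐ s ∂(volume.restrict (Ioo (0:ℝ) 1)), q s ≤ |a s|) :
    IntervalIntegrable (fun s ↦ s ^ (m + 2) * q s) volume 0 1 ∧
      IntervalIntegrable (fun s ↦ s ^ (m + 2) * q s ^ p) volume 0 1 := by
  have hone : IntegrableOn (fun _ : ℝ ↦ (1:ℝ)) (Ioo 0 1) := integrableOn_const (by simp)
  have h0 : ∀ᵐ s ∂(volume.restrict (Ioo (0:ℝ) 1)), s ∈ Ioo (0:ℝ) 1 :=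
    ae_restrict_mem measurableSet_Ioo
  have key : IntegrableOn (fun s ↦ s ^ (m + 2) * q s ^ p) (Ioo 0 1) := by
    refine Integrable.mono' ha (by fun_prop) ?_
    filter_upwards [h0, hqa] with s hs hqs
    have h1 : q s ^ p ≤ |a s| ^ p := Real.rpow_le_rpow (hq0 s) hqs (by linarith)
    have h2 : 0 ≤ s ^ (m + 2) := pow_nonneg hs.1.le _
    rw [Real.norm_of_nonneg (mul_nonneg h2 (Real.rpow_nonneg (hq0 s) _))]
    exact mul_le_mul_of_nonneg_left h1 h2
  rw [intervalIntegrable_iff_integrableOn_Ioo_of_le zero_le_one,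
    intervalIntegrable_iff_integrableOn_Ioo_of_le zero_le_one]
  refine ⟨Integrable.mono' (hone.add key) (by fun_prop) ?_, key⟩
  filter_upwards [h0] with s hs
  have h2 : 0 ≤ s ^ (m + 2) := pow_nonneg hs.1.le _
  have h3 : s ^ (m + 2) ≤ 1 := pow_le_one₀ hs.1.le hs.2.le
  have h4 : 0 ≤ q s ^ p := Real.rpow_nonneg (hq0 s) _
  rw [Real.norm_of_nonneg (mul_nonneg h2 (hq0 s))]
  simp only [Pi.add_apply]
  rcases le_total (q s) 1 with h | h
  · nlinarith [mul_nonneg h2 h4]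
  · nlinarith [Real.self_le_rpow_of_one_le h hp]

lemma IsRadialNeumannSolutionDeriv.radialFlux {m : ℕ} {a g u u' : ℝ → ℝ}
    (hu : IsRadialNeumannSolutionDeriv (m + 3) a u u') (hg : IntervalIntegrable g volume 0 1)
    (hag : ∀ᵐ s ∂(volume.restrict (Ioo (0:ℝ) 1)), s ^ (m + 2) * a s * u s = g s) :
    RadialFlux m u u' g := by
  obtain ⟨hc, hd, hf, hn⟩ := hu
  refine ⟨hc, hd, hg, fun r hr ↦ ?_, hn⟩
  have h1 := hf r hr
  simp only [Nat.add_succ_sub_one] at h1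
  rw [h1, neg_inj]
  refine intervalIntegral.integral_congr_ae ?_
  rw [Measure.restrict_congr_set Ioo_ae_eq_Ioc, ae_restrict_iff' measurableSet_Ioc] at hag
  filter_upwards [hag] with s hs hsr
  rw [uIoc_of_le hr.1.le] at hsr
  exact hs ⟨hsr.1, hsr.2.trans hr.2⟩

lemma NontrivialSol.exists_mem_Ioc {u : ℝ → ℝ} (hu : NontrivialSol u)
    (hc : ContinuousOn u (Icc 0 1)) : ∃ r ∈ Ioc (0:ℝ) 1, u r ≠ 0 := by
  by_contra! h
  obtain ⟨r, hr, hur⟩ := hu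
  rcases hr.1.eq_or_lt with rfl | hr0
  · refine hur (tendsto_nhds_unique (f := u) (l := nhdsWithin 0 (Ioi 0)) ?_ ?_)
    · rw [← nhdsWithin_Ioc_eq_nhdsGT one_pos]
      exact (hc 0 hr).mono_left (nhdsWithin_mono _ Ioc_subset_Icc_self)
    · refine tendsto_const_nhds.congr' ?_
      rw [← nhdsWithin_Ioc_eq_nhdsGT one_pos]
      filter_upwards [self_mem_nhdsWithin] with x hx using (h x hx).symm
  · exact hur (h r ⟨hr0, hr.2⟩)

/-- Potentials in the admissible class stay away from the eigenvalue in the critical space. -/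
lemma exists_integral_lower_bound {m k : ℕ} {μ : ℝ} {φ : ℝ → ℝ} {rz : ℕ → ℝ}
    (hek : IsRadialNeumannEigenpair (m + 3) k μ φ rz) :
    ∃ β₀ : ℝ, 0 < β₀ ∧ ∀ a, GammaSet (m + 3) μ a →
      β₀ ≤ ∫ s in (0:ℝ)..1, s ^ (m + 2) * |a s - μ| ^ (((m + 3 : ℕ) : ℝ) / 2) := by
  obtain ⟨hμ, ⟨φ', hφ⟩, hφ0, -, -, hz, -⟩ := hek
  have hφF : RadialFlux m φ φ' (fun s ↦ s ^ (m + 2) * μ * φ s) := by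
    refine hφ.radialFlux (ContinuousOn.intervalIntegrable ?_) (ae_of_all _ fun s ↦ rfl)
    rw [uIcc_of_le zero_le_one]
    exact ContinuousOn.mul (by fun_prop) hφ.1
  have hφ1 : φ 1 ≠ 0 := fun h ↦ by
    obtain ⟨r, hr, hφr⟩ := hφ0.exists_mem_Ioc hφF.continuousOn
    exact hφr (RadialFlux.eq_zero_of_cauchy_data hμ hφF h r hr)
  obtain ⟨β₀, hβ₀, H⟩ := exists_rigidity_threshold m hμ
  refine ⟨β₀, hβ₀, fun a ⟨ham, ⟨haμ, hapos⟩, ⟨u, ⟨u', hu⟩, hu0⟩, haL⟩ ↦ ?_⟩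
  rw [if_pos (by omega)] at haL
  by_contra! hlt
  have hp : 1 ≤ ((m + 3 : ℕ) : ℝ) / 2 := by
    push_cast
    linarith [(m.cast_nonneg : (0:ℝ) ≤ m)]
  have hqm : Measurable fun s ↦ |a s - μ| := by fun_prop
  obtain ⟨hi, hip⟩ := haL.intervalIntegrable_of_le hp hqm (fun s ↦ abs_nonneg _) <| by
    filter_upwards [haμ] with s hs
    rw [abs_of_nonneg (by linarith), abs_of_nonneg (by linarith)]
    linarith
  have huF : RadialFlux m u u'
      (fun s ↦ s ^ (m + 2) * μ * u s + s ^ (m + 2) * |a s - μ| * u s) := by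
    have huc : ContinuousOn u (uIcc 0 1) := by
      rw [uIcc_of_le zero_le_one]
      exact hu.1
    refine hu.radialFlux (IntervalIntegrable.add (ContinuousOn.intervalIntegrable
      (ContinuousOn.mul (by fun_prop) huc)) (hi.mul_continuousOn huc)) ?_
    filter_upwards [haμ] with s hs
    rw [abs_of_nonneg (by linarith)]
    ring
  obtain ⟨⟨t, ht⟩, hzero⟩ := H _ u u' φ φ' (fun s ↦ abs_nonneg _) hi hip hlt huF hφF hφ1
  have ht0 : t ≠ 0 := by
    rintro rfl
    obtain ⟨r, hr, hur⟩ := hu0.exists_mem_Ioc huF.continuousOn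
    exact hur (by rw [ht r hr, zero_mul])
  have hae : (fun s ↦ s ^ (m + 2) * |a s - μ| * u s ^ 2) =ᵐ[volume.restrict (Ioo (0:ℝ) 1)] 0 := by
    rw [intervalIntegral.integral_of_le zero_le_one, integral_Ioc_eq_integral_Ioo] at hzero
    refine (integral_eq_zero_iff_of_nonneg_ae ?_ ?_).1 hzero
    · filter_upwards [ae_restrict_mem measurableSet_Ioo] with s hs
      have := hs.1
      simp only [Pi.zero_apply]
      positivity
    · have h1 := hi.mul_continuousOn (g := fun s ↦ u s ^ 2) (by
        rw [uIcc_of_le zero_le_one]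
        exact huF.continuousOn.pow 2)
      rwa [intervalIntegrable_iff_integrableOn_Ioo_of_le zero_le_one] at h1
  have hfin : (rz '' Icc 1 k).Finite := (finite_Icc 1 k).image rz
  refine hapos.ne' ?_
  have hnull : ∀ᵐ s, s ∉ {r ∈ Ioo (0:ℝ) 1 | μ < a r} := by
    filter_upwards [(ae_restrict_iff' measurableSet_Ioo).1 hae,
      measure_eq_zero_iff_ae_notMem.1 (hfin.measure_zero volume)] with s hs hsz ⟨hs1, hsa⟩
    have h1 : φ s ≠ 0 := fun h ↦ by
      obtain ⟨i, hi1, hik, rfl⟩ := (hz s hs1).1 h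
      exact hsz ⟨i, ⟨hi1, hik⟩, rfl⟩
    have h2 := hs hs1
    rw [ht s ⟨hs1.1, hs1.2.le⟩] at h2
    have h3 : |a s - μ| ≠ 0 := abs_ne_zero.2 (by linarith)
    have h4 : s ^ (m + 2) ≠ 0 := pow_ne_zero _ hs1.1.ne'
    exact mul_ne_zero (mul_ne_zero h4 h3) (pow_ne_zero 2 (mul_ne_zero ht0 h1)) h2
  exact measure_eq_zero_iff_ae_notMem.2 hnull

/-- The critical case `p = N/2`, `N ≥ 3`: `γ_{N/2,k} > 0`, i.e. there is
`c > 0` with `‖a - μ_k‖_{L^{N/2}(B_1)} ≥ c` for every `a ∈ Γ_k`. -/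
theorem stmt17 (N k : ℕ) (hN : 3 ≤ N) (μk : ℝ) (φk : ℝ → ℝ) (rz : ℕ → ℝ)
    (hek : IsRadialNeumannEigenpair N k μk φk rz) :
    0 < gammaLyap N μk ((N : ℝ) / 2) ∧
    ∃ c : ℝ, 0 < c ∧ ∀ a : ℝ → ℝ, GammaSet N μk a →
      c ≤ radialLpNorm N ((N : ℝ) / 2) (fun r => a r - μk) := by
  obtain ⟨m, rfl⟩ : ∃ m, N = m + 3 := ⟨N - 3, by omega⟩
  obtain ⟨β₀, hβ₀, H⟩ := exists_integral_lower_bound hek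
  have hω : 0 < omegaN (m + 3) := omegaN_pos (by omega)
  set p : ℝ := ((m + 3 : ℕ) : ℝ) / 2 with hp
  have hp0 : 0 < p := by positivity
  have hc : 0 < (omegaN (m + 3) * β₀) ^ (1 / p) := Real.rpow_pos_of_pos (mul_pos hω hβ₀) _
  have hle : ∀ a : ℝ → ℝ, GammaSet (m + 3) μk a →
      (omegaN (m + 3) * β₀) ^ (1 / p) ≤ radialLpNorm (m + 3) p (fun r => a r - μk) := fun a ha ↦
    Real.rpow_le_rpow (mul_pos hω hβ₀).le (mul_le_mul_of_nonneg_left (H a ha) hω.le) (by positivity)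
  refine ⟨lt_of_lt_of_le hc (le_csInf ?_ ?_), _, hc, hle⟩
  · obtain ⟨a, ham, ⟨C, hC⟩, haμ, hu⟩ := exists_bounded_potential hek.1 hek.2.1 hek.2.2.1
    have hL : RadialMemLp (m + 3) p a := RadialMemLp.of_bounded hp0.le ham hC
    exact ⟨_, a, ⟨ham, haμ, hu, by rwa [if_pos hN]⟩, hL, rfl⟩
  · rintro _ ⟨a, ha, -, rfl⟩
    exact hle a ha
end
end

section
/- Let N ≥ 2, p > N/2 and q = 2p/(p−1), and let α(N,p) denote the infimum, over all C^1 functions w : ℝ^N → ℝ that are not identically zero and have compact support contained in the open unit ball B_1, of (∫_{B_1} |∇w|² dx)/(∫_{B_1} |w|^q dx)^{2/q}. Let a be a radial function in L^p(B_1), let u be a nontrivial radial H^1 solution of Δu + a u = 0 in B_1, and let z ∈ (0,1] satisfy u(z) = 0. Then (ω_N ∫_0^z r^{N−1} |a(r)|^p dr)^{1/p} ≥ z^{N/p−2} · α(N,p). -/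
open MeasureTheory Set Filter

noncomputable section

lemma integral_ball_radial (N : ℕ) (hN : 2 ≤ N) (f : ℝ → ℝ) (hf : ∀ r, 1 ≤ r → f r = 0) :
    ∫ x in Metric.ball (0 : EuclideanSpace ℝ (Fin N)) 1, f ‖x‖ =
      omegaN N * ∫ r in Ioi (0 : ℝ), r ^ (N - 1) * f r := by
  have : Nonempty (Fin N) := ⟨⟨0, by omega⟩⟩
  rw [setIntegral_eq_integral_of_forall_compl_eq_zero, integral_fun_norm_addHaar]
  · simp [omegaN, Measure.real, mul_assoc]
  · intro x hx
    exact hf _ (by simpa using hx)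

lemma omegaN_nonneg (N : ℕ) : 0 ≤ omegaN N := by
  unfold omegaN; positivity

/-- The Sobolev inequality on the unit ball, for radial functions with a `C^1` profile `φ`. -/
lemma sobolevQuot_mul_le_radial (N : ℕ) (hN : 2 ≤ N) {q ε ρ : ℝ} (hq : 0 < q) (hε : 0 < ε)
    (hρ : ρ < 1) {φ ψ : ℝ → ℝ} (hφ : ∀ r, HasDerivAt φ (ψ r) r) (hψ : Continuous ψ)
    (hψ0 : ∀ r, r ≤ ε → ψ r = 0) (hφρ : ∀ r, ρ ≤ r → φ r = 0) :
    sobolevQuot N q 1 * (omegaN N * ∫ r in Ioi (0 : ℝ), r ^ (N - 1) * |φ r| ^ q) ^ (2 / q) ≤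
      omegaN N * ∫ r in Ioi (0 : ℝ), r ^ (N - 1) * ψ r ^ 2 := by
  have : Nonempty (Fin N) := ⟨⟨0, by omega⟩⟩
  have hψρ : ∀ r, 1 ≤ r → ψ r = 0 := by
    intro r hr
    have h : φ =ᶠ[nhds r] fun _ => 0 := by
      filter_upwards [Ioi_mem_nhds (hρ.trans_le hr)] with s hs using hφρ s (le_of_lt hs)
    exact (hφ r).unique ((hasDerivAt_const r (0 : ℝ)).congr_of_eventuallyEq h)
  have hconst : ∀ r, r ≤ ε → φ r = φ ε := by
    intro r hr
    have := intervalIntegral.integral_eq_sub_of_hasDerivAt (a := r) (b := ε)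
      (fun x _ => hφ x) (hψ.intervalIntegrable _ _)
    have h0 : ∫ y in r..ε, ψ y = 0 := by
      rw [intervalIntegral.integral_congr (g := fun _ => 0)]
      · simp
      · intro y hy
        rw [uIcc_of_le hr] at hy
        exact hψ0 y hy.2
    linarith
  have hψeq : deriv φ = ψ := funext fun r => (hφ r).deriv
  have hφC : ContDiff ℝ 1 φ := by
    rw [contDiff_one_iff_deriv, hψeq]
    exact ⟨fun r => (hφ r).differentiableAt, hψ⟩
  set w : EuclideanSpace ℝ (Fin N) → ℝ := fun x => φ ‖x‖ with hw
  have hwloc : ∀ x : EuclideanSpace ℝ (Fin N), ‖x‖ < ε → w =ᶠ[nhds x] fun _ => φ ε := by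
    intro x hx
    filter_upwards [(continuous_norm.tendsto x).eventually (gt_mem_nhds hx)] with y hy
    exact hconst _ (le_of_lt hy)
  have hwC : ContDiff ℝ 1 w := by
    rw [contDiff_iff_contDiffAt]
    intro x
    by_cases hx : x = 0
    · exact contDiffAt_const.congr_of_eventuallyEq (hwloc x (by simpa [hx] using hε))
    · exact hφC.contDiffAt.comp x (contDiffAt_norm ℝ hx)
  have hfd : ∀ x, ‖fderiv ℝ w x‖ = |ψ ‖x‖| := by
    intro x
    by_cases hx : x = 0
    · rw [(hwloc x (by simpa [hx] using hε)).fderiv_eq, hψ0 _ (by simpa [hx] using hε.le)]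
      simp
    · have hd : DifferentiableAt ℝ (fun y : EuclideanSpace ℝ (Fin N) => ‖y‖) x :=
        (contDiffAt_norm ℝ hx (n := 1)).differentiableAt (by norm_num)
      have h : HasFDerivAt w (ψ ‖x‖ • fderiv ℝ (fun y : EuclideanSpace ℝ (Fin N) => ‖y‖) x) x :=
        (hφ ‖x‖).comp_hasFDerivAt x hd.hasFDerivAt
      rw [h.fderiv, norm_smul, norm_fderiv_norm hd]
      simp
  have hts : tsupport w ⊆ Metric.ball 0 1 := by
    refine (closure_minimal ?_ Metric.isClosed_closedBall).trans
      (Metric.closedBall_subset_ball hρ)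
    intro x hx
    by_contra h
    rw [mem_closedBall_zero_iff, not_le] at h
    exact hx (hφρ _ h.le)
  have hnum : ∫ x in Metric.ball (0 : EuclideanSpace ℝ (Fin N)) 1, ‖fderiv ℝ w x‖ ^ 2 =
      omegaN N * ∫ r in Ioi (0 : ℝ), r ^ (N - 1) * ψ r ^ 2 := by
    simp_rw [hfd, sq_abs]
    exact integral_ball_radial N hN (fun r => ψ r ^ 2) fun r hr => by simp [hψρ r hr]
  have hden : ∫ x in Metric.ball (0 : EuclideanSpace ℝ (Fin N)) 1, |w x| ^ q =
      omegaN N * ∫ r in Ioi (0 : ℝ), r ^ (N - 1) * |φ r| ^ q :=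
    integral_ball_radial N hN (fun r => |φ r| ^ q) fun r hr => by
      simp [hφρ r (hρ.le.trans hr), hq.ne']
  have hden0 : 0 ≤ ∫ x in Metric.ball (0 : EuclideanSpace ℝ (Fin N)) 1, |w x| ^ q :=
    integral_nonneg fun x => by positivity
  rw [← hnum, ← hden]
  rcases hden0.eq_or_lt with h0 | h0
  · rw [← h0, Real.zero_rpow (by positivity), mul_zero]
    exact integral_nonneg fun x => by positivity
  · rw [← le_div_iff₀ (Real.rpow_pos_of_pos h0 _)]
    refine csInf_le ⟨0, ?_⟩ ⟨w, hwC, ?_, hts, rfl⟩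
    · rintro t ⟨v, -, -, -, rfl⟩
      exact div_nonneg (integral_nonneg fun x => by positivity)
        (Real.rpow_nonneg (integral_nonneg fun x => by positivity) _)
    · by_contra! h
      simp [h, hq.ne'] at h0

/-- The Sobolev inequality on the ball of radius `z`, for radial functions with a `C^1` profile. -/
lemma rpow_mul_sobolevQuot_mul_le_radial (N : ℕ) (hN : 2 ≤ N) {p q ε ρ z : ℝ} (hp : 1 < p)
    (hq : q = 2 * p / (p - 1)) (hε : 0 < ε) (hz : 0 < z)
    (hρ : ρ < z) {φ ψ : ℝ → ℝ} (hφ : ∀ r, HasDerivAt φ (ψ r) r) (hψ : Continuous ψ)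
    (hψ0 : ∀ r, r ≤ ε → ψ r = 0) (hφρ : ∀ r, ρ ≤ r → φ r = 0) :
    z ^ ((N : ℝ) / p - 2) * sobolevQuot N q 1 *
        (omegaN N * ∫ r in Ioi (0 : ℝ), r ^ (N - 1) * |φ r| ^ q) ^ (2 / q) ≤
      omegaN N * ∫ r in Ioi (0 : ℝ), r ^ (N - 1) * ψ r ^ 2 := by
  have hq0 : 0 < q := by rw [hq]; exact div_pos (by linarith) (by linarith)
  have key := sobolevQuot_mul_le_radial N hN (q := q) (ε := ε / z) (ρ := ρ / z) hq0
    (by positivity) (by rwa [div_lt_one hz]) (φ := fun r => φ (z * r))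
    (ψ := fun r => z * ψ (z * r))
    (fun r => by
      have h := (hφ (z * r)).comp r ((hasDerivAt_id r).const_mul z)
      simp only [mul_one] at h
      rw [mul_comm]; exact h)
    (by fun_prop)
    (fun r hr => by
      rw [le_div_iff₀ hz] at hr
      simp [hψ0 (z * r) (by linarith)])
    (fun r hr => by
      rw [div_le_iff₀ hz] at hr
      exact hφρ _ (by linarith))
  have hN1 : (z : ℝ) ^ N = z ^ (N - 1) * z := by
    rw [← pow_succ]; congr 1; omega
  have scale : ∀ f : ℝ → ℝ, ∫ r in Ioi (0 : ℝ), r ^ (N - 1) * f (z * r) =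
      (z ^ N)⁻¹ * ∫ r in Ioi (0 : ℝ), r ^ (N - 1) * f r := by
    intro f
    have h := integral_comp_mul_left_Ioi (fun r => r ^ (N - 1) * f r) 0 hz
    simp only [mul_zero, smul_eq_mul, mul_pow, mul_assoc] at h
    rw [integral_const_mul] at h
    have hz' : z ^ (N - 1) ≠ 0 := by positivity
    rw [hN1, mul_inv, mul_assoc, ← h]
    field_simp
  rw [scale (fun r => |φ r| ^ q)] at key
  have e2 : ∫ r in Ioi (0 : ℝ), r ^ (N - 1) * (z * ψ (z * r)) ^ 2 =
      z ^ 2 * ((z ^ N)⁻¹ * ∫ r in Ioi (0 : ℝ), r ^ (N - 1) * ψ r ^ 2) := by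
    rw [← scale (fun r => ψ r ^ 2), ← integral_const_mul]
    congr 1; ext r; ring
  rw [e2] at key
  set D := ∫ r in Ioi (0 : ℝ), r ^ (N - 1) * |φ r| ^ q with hD
  have hD0 : 0 ≤ D := setIntegral_nonneg measurableSet_Ioi fun r hr => by
    have : (0 : ℝ) < r := hr
    positivity
  have hω := omegaN_nonneg N
  have e3 : (omegaN N * ((z ^ N)⁻¹ * D)) ^ (2 / q) =
      z ^ ((N : ℝ) / p - N) * (omegaN N * D) ^ (2 / q) := by
    rw [show omegaN N * ((z ^ N)⁻¹ * D) = (z ^ N)⁻¹ * (omegaN N * D) by ring,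
      Real.mul_rpow (by positivity) (by positivity)]
    congr 1
    rw [← Real.rpow_natCast, ← Real.rpow_neg hz.le, ← Real.rpow_mul hz.le]
    congr 1
    have : p - 1 ≠ 0 := by linarith
    rw [hq]; field_simp; ring
  rw [e3] at key
  have e4 : z ^ ((N : ℝ) / p - 2) = (z ^ N * (z ^ 2)⁻¹) * z ^ ((N : ℝ) / p - N) := by
    rw [← Real.rpow_natCast, ← Real.rpow_natCast, ← Real.rpow_neg hz.le, ← Real.rpow_add hz,
      ← Real.rpow_add hz]
    congr 1; push_cast; ring
  rw [e4]
  have hzN : 0 < z ^ N * (z ^ 2)⁻¹ := by positivity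
  calc _ = (z ^ N * (z ^ 2)⁻¹) * (sobolevQuot N q 1 *
        (z ^ ((N : ℝ) / p - N) * (omegaN N * D) ^ (2 / q))) := by ring
    _ ≤ (z ^ N * (z ^ 2)⁻¹) * (omegaN N * (z ^ 2 * ((z ^ N)⁻¹ *
        ∫ r in Ioi (0 : ℝ), r ^ (N - 1) * ψ r ^ 2))) := mul_le_mul_of_nonneg_left key hzN.le
    _ = _ := by field_simp

lemma sobolevQuot_nonneg (N : ℕ) (q ρ : ℝ) : 0 ≤ sobolevQuot N q ρ := by
  refine Real.sInf_nonneg ?_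
  rintro t ⟨v, -, -, -, rfl⟩
  exact div_nonneg (integral_nonneg fun x => by positivity)
    (Real.rpow_nonneg (integral_nonneg fun x => by positivity) _)

/-- A continuous cutoff function supported inside `(ε, z)`. -/
def cutoff (ε z : ℝ) (n : ℕ) (s : ℝ) : ℝ := max 0 (min 1 (n * min (s - ε) (z - s) - 1))

lemma continuous_cutoff (ε z : ℝ) (n : ℕ) : Continuous (cutoff ε z n) := by
  unfold cutoff; fun_prop

lemma cutoff_nonneg (ε z : ℝ) (n : ℕ) (s : ℝ) : 0 ≤ cutoff ε z n s := le_max_left _ _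

lemma cutoff_le_one (ε z : ℝ) (n : ℕ) (s : ℝ) : cutoff ε z n s ≤ 1 :=
  max_le zero_le_one (min_le_left _ _)

lemma cutoff_eq_zero {ε z : ℝ} {n : ℕ} {s : ℝ} (h : n * min (s - ε) (z - s) ≤ 1) :
    cutoff ε z n s = 0 :=
  max_eq_left ((min_le_right _ _).trans (by linarith))

lemma cutoff_eq_zero_of_le {ε z : ℝ} {n : ℕ} {s : ℝ} (h : s ≤ ε) : cutoff ε z n s = 0 := by
  refine cutoff_eq_zero (le_trans ?_ zero_le_one)
  exact mul_nonpos_of_nonneg_of_nonpos (Nat.cast_nonneg n) ((min_le_left _ _).trans (by linarith))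

lemma cutoff_eq_zero_of_sub_le {ε z : ℝ} {n : ℕ} (hn : 0 < n) {s : ℝ} (h : z - 1 / n ≤ s) :
    cutoff ε z n s = 0 := by
  have hn' : (0 : ℝ) < n := by exact_mod_cast hn
  refine cutoff_eq_zero ((mul_le_mul_of_nonneg_left (min_le_right _ _) hn'.le).trans ?_)
  have : z - s ≤ 1 / n := by linarith
  rw [le_div_iff₀ hn'] at this
  linarith

lemma tendsto_cutoff {ε z s : ℝ} (hs : s ∈ Ioo ε z) :
    Tendsto (fun n => cutoff ε z n s) atTop (nhds 1) := by
  have hpos : 0 < min (s - ε) (z - s) := lt_min (by linarith [hs.1]) (by linarith [hs.2])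
  refine tendsto_const_nhds.congr' ?_
  have h := (tendsto_natCast_atTop_atTop (R := ℝ)).atTop_mul_const hpos
  filter_upwards [h.eventually_ge_atTop 2] with n hn
  unfold cutoff
  rw [min_eq_left (by linarith), max_eq_right zero_le_one]

/-- The Sobolev inequality for a profile on `[ε, z]` vanishing at `z`. -/
lemma rpow_mul_sobolevQuot_mul_le_interval (N : ℕ) (hN : 2 ≤ N) {p q ε z : ℝ} (hp : 1 < p)
    (hq : q = 2 * p / (p - 1)) (hε : 0 < ε) (hεz : ε < z) {u g : ℝ → ℝ}
    (hu : ContinuousOn u (Icc ε z)) (hg : Continuous g)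
    (hd : ∀ r ∈ Ioo ε z, HasDerivAt u (g r) r) (huz : u z = 0) :
    z ^ ((N : ℝ) / p - 2) * sobolevQuot N q 1 *
        (omegaN N * ∫ r in ε..z, r ^ (N - 1) * |u r| ^ q) ^ (2 / q) ≤
      omegaN N * ∫ r in ε..z, r ^ (N - 1) * g r ^ 2 := by
  have hz : 0 < z := hε.trans hεz
  have hq0 : 0 < q := by rw [hq]; exact div_pos (by linarith) (by linarith)
  have hω := omegaN_nonneg N
  obtain ⟨M, hM⟩ := isCompact_Icc.exists_bound_of_continuousOn (s := Icc ε z) hg.continuousOn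
  have hM0 : 0 ≤ M := (norm_nonneg _).trans (hM ε (left_mem_Icc.2 hεz.le))
  let ψ : ℕ → ℝ → ℝ := fun n s => cutoff ε z n s * g s
  have hψc : ∀ n, Continuous (ψ n) := fun n => (continuous_cutoff ε z n).mul hg
  let φ : ℕ → ℝ → ℝ := fun n r => ∫ s in z..r, ψ n s
  have hφd : ∀ n r, HasDerivAt (φ n) (ψ n r) r := fun n r =>
    intervalIntegral.integral_hasDerivAt_right ((hψc n).intervalIntegrable _ _)
      ((hψc n).stronglyMeasurableAtFilter _ _) (hψc n).continuousAt
  have hφc : ∀ n, Continuous (φ n) := fun n =>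
    continuous_iff_continuousAt.2 fun r => (hφd n r).continuousAt
  have hψM : ∀ n, ∀ s ∈ Icc ε z, ‖ψ n s‖ ≤ M := by
    intro n s hs
    rw [norm_mul, Real.norm_of_nonneg (cutoff_nonneg ε z n s)]
    calc _ ≤ 1 * M := mul_le_mul (cutoff_le_one ε z n s) (hM s hs) (norm_nonneg _) zero_le_one
      _ = M := one_mul M
  have hφlim : ∀ r ∈ Ioo ε z, Tendsto (fun n => φ n r) atTop (nhds (u r)) := by
    intro r hr
    have hur : u r = ∫ s in z..r, g s := by
      rw [intervalIntegral.integral_symm, intervalIntegral.integral_eq_sub_of_hasDerivAt_of_le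
        hr.2.le (hu.mono (Icc_subset_Icc_left hr.1.le))
        (fun x hx => hd x ⟨hr.1.trans hx.1, hx.2⟩) (hg.intervalIntegrable _ _), huz]
      ring
    rw [hur]
    refine intervalIntegral.tendsto_integral_filter_of_dominated_convergence (fun _ => M)
      (Eventually.of_forall fun n => (hψc n).aestronglyMeasurable)
      (Eventually.of_forall fun n => ae_of_all _ fun s hs => ?_) (by simp) ?_
    · rw [uIoc_of_ge hr.2.le] at hs
      exact hψM n s ⟨hr.1.le.trans hs.1.le, hs.2⟩
    · have : ∀ᵐ s : ℝ, s ≠ z := by simp [ae_iff, measure_singleton]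
      filter_upwards [this] with s hsz hs
      rw [uIoc_of_ge hr.2.le] at hs
      simpa using (tendsto_cutoff ⟨hr.1.trans hs.1, lt_of_le_of_ne hs.2 hsz⟩).mul_const (g s)
  have hφM : ∀ n, ∀ r ∈ Ioc ε z, |φ n r| ≤ M * (z - ε) := by
    intro n r hr
    have := intervalIntegral.norm_integral_le_of_norm_le_const (a := z) (b := r) (f := ψ n) (C := M)
      (fun s hs => by
        rw [uIoc_of_ge hr.2] at hs
        exact hψM n s ⟨hr.1.le.trans hs.1.le, hs.2⟩)
    rw [abs_of_nonpos (by linarith [hr.2])] at this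
    exact this.trans (mul_le_mul_of_nonneg_left (by linarith [hr.1]) hM0)
  have hlim : Tendsto (fun n => ∫ r in ε..z, r ^ (N - 1) * |φ n r| ^ q) atTop
      (nhds (∫ r in ε..z, r ^ (N - 1) * |u r| ^ q)) := by
    refine intervalIntegral.tendsto_integral_filter_of_dominated_convergence
      (fun _ => z ^ (N - 1) * (M * (z - ε)) ^ q)
      (Eventually.of_forall fun n => ?_)
      (Eventually.of_forall fun n => ae_of_all _ fun r hr => ?_) (by simp) ?_
    · have h1 := hφc n
      have : Continuous fun r => r ^ (N - 1) * |φ n r| ^ q :=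
        (continuous_id.pow _).mul (h1.abs.rpow_const fun _ => Or.inr hq0.le)
      exact this.aestronglyMeasurable
    · rw [uIoc_of_le hεz.le] at hr
      have hr0 : 0 < r := hε.trans hr.1
      rw [Real.norm_of_nonneg (by positivity)]
      have := hφM n r hr
      have h2 := hr.2
      gcongr
    · have : ∀ᵐ s : ℝ, s ≠ z := by simp [ae_iff, measure_singleton]
      filter_upwards [this] with s hsz hs
      rw [uIoc_of_le hεz.le] at hs
      exact (((hφlim s ⟨hs.1, lt_of_le_of_ne hs.2 hsz⟩).abs).rpow_const
        (Or.inr hq0.le)).const_mul _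
  have hlim2 := (((hlim.const_mul (omegaN N)).rpow_const (p := 2 / q)
    (Or.inr (by positivity))).const_mul (z ^ ((N : ℝ) / p - 2) * sobolevQuot N q 1))
  refine le_of_tendsto hlim2 ?_
  filter_upwards [eventually_gt_atTop 0] with n hn
  have hn' : (0 : ℝ) < 1 / n := by
    have : (0 : ℝ) < n := by exact_mod_cast hn
    positivity
  have hψz : ∀ r, z - 1 / n ≤ r → ψ n r = 0 := fun r hr => by
    simp only [ψ, cutoff_eq_zero_of_sub_le hn hr, zero_mul]
  have hψε : ∀ r, r ≤ ε → ψ n r = 0 := fun r hr => by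
    simp only [ψ, cutoff_eq_zero_of_le hr, zero_mul]
  have hφz : ∀ r, z - 1 / n ≤ r → φ n r = 0 := by
    intro r hr
    refine (intervalIntegral.integral_congr (g := fun _ => 0) fun s hs => ?_).trans (by simp)
    refine hψz s ((le_min (by linarith) hr).trans hs.1)
  have key := rpow_mul_sobolevQuot_mul_le_radial N hN hp hq hε hz (by linarith) (hφd n) (hψc n)
    hψε hφz
  have hIoc : ∀ f : ℝ → ℝ, (∀ r, z ≤ r → f r = 0) → Continuous f →
      IntegrableOn (fun r => r ^ (N - 1) * f r) (Ioi 0) := by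
    intro f hf hfc
    rw [← Ioc_union_Ioi_eq_Ioi hz.le]
    refine IntegrableOn.union ?_ ?_
    · exact ((by fun_prop : Continuous fun r => r ^ (N - 1) * f r).integrableOn_Icc).mono_set
        Ioc_subset_Icc_self
    · refine integrableOn_zero.congr_fun (fun r hr => ?_) measurableSet_Ioi
      simp [hf r (le_of_lt hr)]
  refine le_trans (mul_le_mul_of_nonneg_left ?_ (mul_nonneg (by positivity)
    (sobolevQuot_nonneg N q 1))) (key.trans (mul_le_mul_of_nonneg_left ?_ hω))
  · refine Real.rpow_le_rpow (mul_nonneg hω (intervalIntegral.integral_nonneg hεz.le fun r hr => ?_))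
      (mul_le_mul_of_nonneg_left ?_ hω) (by positivity)
    · have := hε.le.trans hr.1; positivity
    · rw [intervalIntegral.integral_of_le hεz.le]
      refine setIntegral_mono_set (hIoc (fun r => |φ n r| ^ q) (fun r hr => ?_)
        ((hφc n).abs.rpow_const fun _ => Or.inr hq0.le)) ?_ ?_
      · simp [hφz r (by linarith), hq0.ne']
      · filter_upwards [ae_restrict_mem measurableSet_Ioi] with r hr
        have : (0 : ℝ) < r := hr
        simp only [Pi.zero_apply]; positivity
      · exact (show Ioc ε z ⊆ Ioi 0 from fun r hr => hε.trans hr.1).eventuallyLE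
  · have e : ∫ r in Ioi (0 : ℝ), r ^ (N - 1) * ψ n r ^ 2 =
        ∫ r in ε..z, r ^ (N - 1) * ψ n r ^ 2 := by
      rw [intervalIntegral.integral_of_le hεz.le]
      refine (setIntegral_eq_of_subset_of_forall_sdiff_eq_zero measurableSet_Ioi
        (fun r hr => hε.trans hr.1) fun r hr => ?_)
      rcases le_or_gt r ε with h | h
      · simp [hψε r h]
      · have : z < r := by
          by_contra! h'
          exact hr.2 ⟨h, h'⟩
        simp [hψz r (by linarith)]
    rw [e]
    have h1 := hψc n
    refine intervalIntegral.integral_mono_on hεz.le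
      (Continuous.intervalIntegrable (by fun_prop) _ _)
      (Continuous.intervalIntegrable (by fun_prop) _ _) fun r hr => ?_
    have hr0 : 0 < r := hε.trans_le hr.1
    refine mul_le_mul_of_nonneg_left ?_ (by positivity)
    simp only [ψ, mul_pow]
    have h2 := cutoff_nonneg ε z n r
    have h3 := cutoff_le_one ε z n r
    have : cutoff ε z n r ^ 2 ≤ 1 := by nlinarith
    nlinarith [sq_nonneg (g r)]

/-- Integration by parts for primitives of integrable functions. -/
lemma integral_primitive_mul_add {a b A B : ℝ} {f g F G : ℝ → ℝ} (hab : a ≤ b)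
    (hf : IntervalIntegrable f volume a b) (hg : IntervalIntegrable g volume a b)
    (hF : ∀ x ∈ Icc a b, F x = A + ∫ t in a..x, f t)
    (hG : ∀ x ∈ Icc a b, G x = B + ∫ t in a..x, g t) :
    ∫ x in a..b, (f x * G x + F x * g x) = F b * G b - A * B := by
  have hconst : ∀ c : ℝ, AbsolutelyContinuousOnInterval (fun _ : ℝ => c) a b := fun c =>
    ((LipschitzWith.const c).lipschitzOnWith (s := uIcc a b)).absolutelyContinuousOnInterval
  have hacF := (hconst A).add
    (hf.absolutelyContinuousOnInterval_intervalIntegral (c := a) left_mem_uIcc)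
  have hacG := (hconst B).add
    (hg.absolutelyContinuousOnInterval_intervalIntegral (c := a) left_mem_uIcc)
  have key := hacF.integral_deriv_mul_eq_sub hacG
  simp only [Pi.add_apply, intervalIntegral.integral_same, add_zero] at key
  rw [hF b (right_mem_Icc.2 hab), hG b (right_mem_Icc.2 hab), ← key]
  refine intervalIntegral.integral_congr_ae ?_
  filter_upwards [hf.ae_hasDerivAt_integral, hg.ae_hasDerivAt_integral] with x hxf hxg hx
  have hx' := uIoc_subset_uIcc hx
  have h1 := ((hxf hx' a left_mem_uIcc).const_add A).deriv
  have h2 := ((hxg hx' a left_mem_uIcc).const_add B).deriv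
  rw [uIcc_of_le hab] at hx'
  rw [hF x hx', hG x hx']
  erw [h1, h2]

lemma RadialMemLp.integrableOn_pow_mul {N : ℕ} {p : ℝ} {a : ℝ → ℝ} (hp : 1 < p)
    (hmeas : Measurable a) (ha : RadialMemLp N p a) :
    IntegrableOn (fun t => t ^ (N - 1) * a t) (Icc 0 1) := by
  rw [integrableOn_Icc_iff_integrableOn_Ioo]
  have h1 : IntegrableOn (fun t : ℝ => t ^ (N - 1)) (Ioo 0 1) :=
    ((continuous_pow (N - 1)).integrableOn_Icc).mono_set Ioo_subset_Icc_self
  refine (h1.add ha).mono' (by fun_prop) ?_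
  filter_upwards [ae_restrict_mem measurableSet_Ioo] with t ht
  have ht0 : 0 < t := ht.1
  rw [norm_mul, Real.norm_of_nonneg (by positivity), Real.norm_eq_abs, Pi.add_apply]
  have h2 : |a t| ≤ 1 + |a t| ^ p := by
    rcases le_total |a t| 1 with h | h
    · have : 0 ≤ |a t| ^ p := by positivity
      linarith
    · have := Real.self_le_rpow_of_one_le h hp.le
      linarith
  have h3 : 0 ≤ t ^ (N - 1) := by positivity
  nlinarith

namespace IsRadialH1Solution

variable {N : ℕ} {a u u' : ℝ → ℝ}

lemma integrableOn (hu : IsRadialH1Solution N a u u')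
    (ha : IntegrableOn (fun t => t ^ (N - 1) * a t) (Icc 0 1)) {ε : ℝ} (hε : 0 < ε) :
    IntegrableOn (fun t => t ^ (N - 1) * a t * u t) (Icc ε 1) :=
  (ha.mono_set (Icc_subset_Icc_left hε.le)).mul_continuousOn
    (hu.1.mono fun _ ht => ⟨hε.trans_le ht.1, ht.2⟩) isCompact_Icc

lemma exists_continuous_deriv (hu : IsRadialH1Solution N a u u')
    (ha : IntegrableOn (fun t => t ^ (N - 1) * a t) (Icc 0 1)) {ε : ℝ} (hε : ε ∈ Ioo (0 : ℝ) 1) :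
    ∃ g : ℝ → ℝ, Continuous g ∧ (∀ r ∈ Ico ε 1, g r = u' r) ∧
      ∀ r ∈ Icc ε 1, r ^ (N - 1) * g r =
        ε ^ (N - 1) * u' ε + ∫ t in ε..r, -(t ^ (N - 1) * a t * u t) := by
  have hint := hu.integrableOn ha hε.1
  have hpos : ∀ r ∈ Icc ε 1, r ^ (N - 1) ≠ 0 := fun r hr => by
    have := hε.1.trans_le hr.1
    positivity
  let h : ℝ → ℝ := fun r =>
    (ε ^ (N - 1) * u' ε + ∫ t in ε..r, -(t ^ (N - 1) * a t * u t)) / r ^ (N - 1)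
  have hh : ContinuousOn h (Icc ε 1) := by
    have h1 := intervalIntegral.continuousOn_primitive_interval (a := ε) (b := 1)
      (f := fun t => -(t ^ (N - 1) * a t * u t)) (μ := volume)
      (by rw [uIcc_of_le hε.2.le]; exact hint.neg)
    rw [uIcc_of_le hε.2.le] at h1
    exact (continuousOn_const.add h1).div (by fun_prop) hpos
  refine ⟨IccExtend hε.2.le ((Icc ε 1).domRestrict h), ?_, ?_, ?_⟩
  · exact (continuousOn_iff_continuous_domRestrict.1 hh).Icc_extend'
  · intro r hr
    rw [IccExtend_of_mem _ _ (⟨hr.1, hr.2.le⟩ : r ∈ Icc ε 1), domRestrict_apply]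
    have hne := hpos r (Ico_subset_Icc_self hr)
    simp only [h]
    rw [div_eq_iff hne]
    rcases hr.1.eq_or_lt with rfl | hlt
    · simp [mul_comm]
    · have := hu.2.2.1 ε hε r ⟨hε.1.trans hlt, hr.2⟩ hlt
      rw [intervalIntegral.integral_neg]
      linarith
  · intro r hr
    rw [IccExtend_of_mem _ _ hr, domRestrict_apply]
    exact mul_div_cancel₀ _ (hpos r hr)

/-- The energy identity on `[ε, z]`. -/
lemma integral_sq_deriv_eq (hu : IsRadialH1Solution N a u u')
    (ha : IntegrableOn (fun t => t ^ (N - 1) * a t) (Icc 0 1)) {ε z : ℝ}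
    (hε : 0 < ε) (hεz : ε < z) (hz : z ≤ 1) (huz : u z = 0) {g : ℝ → ℝ} (hg : Continuous g)
    (hgu : ∀ r ∈ Ico ε 1, g r = u' r)
    (hgP : ∀ r ∈ Icc ε 1, r ^ (N - 1) * g r =
      ε ^ (N - 1) * u' ε + ∫ t in ε..r, -(t ^ (N - 1) * a t * u t)) :
    ∫ r in ε..z, r ^ (N - 1) * g r ^ 2 =
      (∫ r in ε..z, r ^ (N - 1) * a r * u r ^ 2) - ε ^ (N - 1) * u' ε * u ε := by
  have hsub : Icc ε z ⊆ Icc ε 1 := Icc_subset_Icc_right hz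
  have hint := (hu.integrableOn ha hε).mono_set hsub
  have huc : ContinuousOn u (Icc ε z) := hu.1.mono fun r hr => ⟨hε.trans_le hr.1, hr.2.trans hz⟩
  have hint' : IntervalIntegrable (fun t => -(t ^ (N - 1) * a t * u t)) volume ε z :=
    ((intervalIntegrable_iff_integrableOn_Icc_of_le hεz.le).2 hint).neg
  have hint2 : IntervalIntegrable (fun t => t ^ (N - 1) * a t * u t * u t) volume ε z :=
    (intervalIntegrable_iff_integrableOn_Icc_of_le hεz.le).2
      (hint.mul_continuousOn huc isCompact_Icc)
  have hG : ∀ x ∈ Icc ε z, u x = u ε + ∫ t in ε..x, g t := by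
    intro x hx
    rw [intervalIntegral.integral_eq_sub_of_hasDerivAt_of_le hx.1
      (huc.mono (Icc_subset_Icc_right hx.2)) (f' := g) (fun r hr => ?_) (hg.intervalIntegrable _ _)]
    · ring
    · have hr1 : r < 1 := hr.2.trans_le (hx.2.trans hz)
      rw [hgu r ⟨hr.1.le, hr1⟩]
      exact hu.2.1 r ⟨hε.trans hr.1, hr1⟩
  have key := integral_primitive_mul_add hεz.le hint' (hg.intervalIntegrable _ _)
    (fun x hx => hgP x (hsub hx)) hG
  rw [huz] at key
  have e : ∫ x in ε..z, (-(x ^ (N - 1) * a x * u x) * u x + x ^ (N - 1) * g x * g x) =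
      -(∫ r in ε..z, r ^ (N - 1) * a r * u r * u r) + ∫ r in ε..z, r ^ (N - 1) * g r ^ 2 := by
    have hg2 : IntervalIntegrable (fun r => r ^ (N - 1) * g r ^ 2) volume ε z :=
      Continuous.intervalIntegrable (by fun_prop) _ _
    have hint3 : IntervalIntegrable (fun t => -(t ^ (N - 1) * a t * u t * u t)) volume ε z :=
      hint2.neg
    rw [← intervalIntegral.integral_neg, ← intervalIntegral.integral_add hint3 hg2]
    congr 1; ext x; ring
  rw [e] at key
  have e2 : ∫ r in ε..z, r ^ (N - 1) * a r * u r ^ 2 =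
      ∫ r in ε..z, r ^ (N - 1) * a r * u r * u r := by
    congr 1; ext x; ring
  rw [e2]
  linarith

/-- A solution of finite energy has no outward flux at the origin. -/
lemma exists_neg_flux_lt (hN : 2 ≤ N) (hu : IsRadialH1Solution N a u u')
    {c δ : ℝ} (hc : 0 < c) (hδ : 0 < δ) (hδ1 : δ < 1) :
    ∃ ε ∈ Ioc (0 : ℝ) δ, -(ε ^ (N - 1) * u' ε * u ε) < c := by
  by_contra! H
  have hder : ∀ r ∈ Ioc (0 : ℝ) δ, HasDerivAt u (u' r) r := fun r hr =>
    hu.2.1 r ⟨hr.1, hr.2.trans_lt hδ1⟩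
  have hpow : ∀ r ∈ Ioc (0 : ℝ) δ, 0 < r ^ (N - 1) ∧ r ^ (N - 1) ≤ r := fun r hr =>
    ⟨pow_pos hr.1 _, pow_le_of_le_one hr.1.le (hr.2.trans hδ1.le) (by omega)⟩
  have hne : ∀ r ∈ Ioc (0 : ℝ) δ, u r ≠ 0 := by
    intro r hr h0
    have := H r hr
    simp only [h0, mul_zero, neg_zero] at this
    linarith
  set E := ∫ r in Ioo (0 : ℝ) 1, r ^ (N - 1) * ((u' r) ^ 2 + (u r) ^ 2) with hE
  have hEint := hu.2.2.2
  have hlog : ∀ r ∈ Ioc (0 : ℝ) δ, Real.log (u r) ≤ Real.log (u δ) + E / c := by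
    intro r hr
    have hsub : Icc r δ ⊆ Ioo 0 1 := fun s hs => ⟨hr.1.trans_le hs.1, hs.2.trans_lt hδ1⟩
    have hsub' : Icc r δ ⊆ Ioc 0 δ := fun s hs => ⟨hr.1.trans_le hs.1, hs.2⟩
    have hd : ∀ s ∈ Icc r δ, HasDerivAt (fun s => -Real.log (u s)) (-(u' s / u s)) s :=
      fun s hs => ((hder s (hsub' hs)).log (hne s (hsub' hs))).neg
    have h := intervalIntegral.sub_le_integral_of_hasDeriv_right_of_le hr.2
      (g := fun s => -Real.log (u s)) (g' := fun s => -(u' s / u s))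
      (φ := fun s => s ^ (N - 1) * ((u' s) ^ 2 + (u s) ^ 2) / c)
      (fun s hs => (hd s hs).continuousAt.continuousWithinAt)
      (fun s hs => (hd s (Ioo_subset_Icc_self hs)).hasDerivWithinAt)
      ((hEint.mono_set hsub).div_const c)
      (fun s hs => by
        have hs' := hsub' (Ioo_subset_Icc_self hs)
        have hus := hne s hs'
        obtain ⟨hp0, -⟩ := hpow s hs'
        have hH := H s hs'
        have hu2 : 0 < u s ^ 2 := by positivity
        rw [le_div_iff₀ hc]
        have e : -(u' s / u s) = -(u' s * u s) / u s ^ 2 := by field_simp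
        rw [e, div_mul_eq_mul_div, div_le_iff₀ hu2]
        have hpos : 0 ≤ -(u' s * u s) := by
          by_contra! hneg
          nlinarith
        calc -(u' s * u s) * c ≤ -(u' s * u s) * -(s ^ (N - 1) * u' s * u s) :=
              mul_le_mul_of_nonneg_left hH hpos
          _ = s ^ (N - 1) * (u' s ^ 2) * u s ^ 2 := by ring
          _ ≤ s ^ (N - 1) * (u' s ^ 2 + u s ^ 2) * u s ^ 2 := by gcongr; linarith)
    have h2 : ∫ s in r..δ, s ^ (N - 1) * ((u' s) ^ 2 + (u s) ^ 2) / c ≤ E / c := by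
      rw [intervalIntegral.integral_div, intervalIntegral.integral_of_le hr.2]
      refine div_le_div_of_nonneg_right (setIntegral_mono_set hEint ?_ ?_) hc.le
      · filter_upwards [ae_restrict_mem measurableSet_Ioo] with s hs
        have := hs.1
        simp only [Pi.zero_apply]; positivity
      · exact (Ioc_subset_Icc_self.trans hsub).eventuallyLE
    linarith
  have hbdd : ∀ r ∈ Ioc (0 : ℝ) δ, u r ^ 2 ≤ Real.exp (Real.log (u δ) + E / c) ^ 2 := by
    intro r hr
    rw [← sq_abs (u r), ← Real.exp_log_eq_abs (hne r hr)]
    gcongr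
    exact hlog r hr
  set K := Real.exp (Real.log (u δ) + E / c) ^ 2 with hK
  have hanti : ∀ r ∈ Ioc (0 : ℝ) δ, 2 * c * (Real.log δ - Real.log r) ≤ K := by
    intro r hr
    have hsub' : Icc r δ ⊆ Ioc 0 δ := fun s hs => ⟨hr.1.trans_le hs.1, hs.2⟩
    have hd : ∀ s ∈ Icc r δ, HasDerivAt (fun s => u s ^ 2 + 2 * c * Real.log s)
        (2 * u s * u' s + 2 * c * s⁻¹) s := by
      intro s hs
      have h1 := ((hder s (hsub' hs)).pow 2).add
        ((Real.hasDerivAt_log (hsub' hs).1.ne').const_mul (2 * c))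
      refine h1.congr_deriv ?_
      norm_num
    have h := antitoneOn_of_deriv_nonpos (convex_Icc r δ)
      (fun s hs => (hd s hs).continuousAt.continuousWithinAt)
      (fun s hs => (hd s (interior_subset hs)).differentiableAt.differentiableWithinAt)
      (fun s hs => by
        have hs' := hsub' (interior_subset hs)
        rw [(hd s (interior_subset hs)).deriv]
        obtain ⟨hp0, hp1⟩ := hpow s hs'
        have hH := H s hs'
        have hs0 := hs'.1
        have hpos : 0 ≤ -(u' s * u s) := by
          by_contra! hneg
          nlinarith
        have h3 : c ≤ s * -(u' s * u s) := by nlinarith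
        have h4 : c * s⁻¹ ≤ -(u' s * u s) := by
          rw [← div_eq_mul_inv, div_le_iff₀ hs0]; linarith
        linarith)
      (left_mem_Icc.2 hr.2) (right_mem_Icc.2 hr.2) hr.2
    nlinarith [hbdd r hr, sq_nonneg (u δ)]
  have hr0 : δ * Real.exp (-(K + 1) / (2 * c)) ∈ Ioc 0 δ := by
    refine ⟨by positivity, mul_le_of_le_one_right hδ.le (Real.exp_le_one_iff.2 ?_)⟩
    have hK0 : 0 ≤ K := sq_nonneg _
    exact div_nonpos_of_nonpos_of_nonneg (by linarith) (by positivity)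
  have := hanti _ hr0
  rw [Real.log_mul hδ.ne' (Real.exp_pos _).ne', Real.log_exp] at this
  field_simp at this
  linarith

/-- A solution vanishing near the origin vanishes identically. -/
lemma eq_zero_of_eq_zero_near_zero (hu : IsRadialH1Solution N a u u')
    (ha : IntegrableOn (fun t => t ^ (N - 1) * a t) (Icc 0 1)) {z : ℝ} (hz : z ∈ Ioc (0 : ℝ) 1)
    (h0 : ∀ r ∈ Ioo 0 z, u r = 0) : ∀ r ∈ Ioc (0 : ℝ) 1, u r = 0 := by
  obtain ⟨s₀, hs₀⟩ : ∃ s₀, s₀ ∈ Ioo 0 z := nonempty_Ioo.2 hz.1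
  have hs₁ : s₀ ∈ Ioo (0 : ℝ) 1 := ⟨hs₀.1, hs₀.2.trans_le hz.2⟩
  obtain ⟨g, hg, hgu, hgP⟩ := hu.exists_continuous_deriv ha hs₁
  have hu's₀ : u' s₀ = 0 := by
    have h : u =ᶠ[nhds s₀] fun _ => 0 := by
      filter_upwards [Ioo_mem_nhds hs₀.1 hs₀.2] with s hs using h0 s hs
    exact (hu.2.1 s₀ hs₁).unique ((hasDerivAt_const s₀ (0 : ℝ)).congr_of_eventuallyEq h)
  have huc : ContinuousOn u (Icc s₀ 1) := hu.1.mono fun r hr => ⟨hs₀.1.trans_le hr.1, hr.2⟩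
  have haint := ha.mono_set (Icc_subset_Icc_left (b := (1 : ℝ)) hs₀.1.le)
  set A := ∫ t in Icc s₀ 1, |t ^ (N - 1) * a t| with hA
  have hA0 : 0 ≤ A := integral_nonneg fun t => abs_nonneg _
  have hs₀N : 0 < s₀ ^ (N - 1) := pow_pos hs₀.1 _
  set C := A / s₀ ^ (N - 1) with hC
  have hC0 : 0 ≤ C := by positivity
  have hfar : Icc s₀ 1 ⊆ {t | ∀ r ∈ Icc s₀ t, u r = 0} := by
    refine IsClosed.Icc_subset_of_forall_exists_gt ?_ ?_ ?_
    · refine IsSeqClosed.isClosed fun t x ht htx => ?_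
      have hx : x ∈ Icc s₀ 1 := isClosed_Icc.mem_of_tendsto htx (Eventually.of_forall fun n => (ht n).2)
      refine ⟨fun r hr => ?_, hx⟩
      rcases hr.2.lt_or_eq with hlt | rfl
      · obtain ⟨n, hn⟩ := (htx.eventually (lt_mem_nhds hlt)).exists
        exact (ht n).1 r ⟨hr.1, hn.le⟩
      · have h1 : Tendsto (fun n => u (t n)) atTop (nhds (u r)) :=
          (huc r hx).tendsto.comp (tendsto_nhdsWithin_iff.2
            ⟨htx, Eventually.of_forall fun n => (ht n).2⟩)
        refine tendsto_nhds_unique h1 (tendsto_const_nhds.congr fun n => ?_)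
        exact ((ht n).1 (t n) ⟨(ht n).2.1, le_rfl⟩).symm
    · intro r hr
      rw [le_antisymm hr.2 hr.1]
      exact h0 s₀ hs₀
    · rintro x ⟨hx0, hx⟩ y hy
      have hxy : x < y := hy
      set d := min (min y 1) (x + 1 / (2 * (C + 1))) with hd
      have hxd : x < d := by
        refine lt_min (lt_min hxy hx.2) ?_
        have : 0 < 1 / (2 * (C + 1)) := by positivity
        linarith
      have hdy : d ≤ y := (min_le_left _ _).trans (min_le_left _ _)
      have hd1 : d ≤ 1 := (min_le_left _ _).trans (min_le_right _ _)
      have hdx : d ≤ x + 1 / (2 * (C + 1)) := min_le_right _ _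
      refine ⟨d, ?_, hxd, hdy⟩
      have hsd : Icc s₀ d ⊆ Icc s₀ 1 := Icc_subset_Icc_right hd1
      obtain ⟨m, hm, hmax⟩ := isCompact_Icc.exists_isMaxOn (nonempty_Icc.2 (hx.1.trans hxd.le))
        (huc.mono hsd).abs
      set M := |u m| with hM
      have hgb : ∀ r ∈ Icc s₀ d, ‖g r‖ ≤ C * M := by
        intro r hr
        have h1 := hgP r (hsd hr)
        rw [hu's₀, mul_zero, zero_add] at h1
        have h2 : ‖∫ t in s₀..r, -(t ^ (N - 1) * a t * u t)‖ ≤ A * M := by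
          rw [intervalIntegral.integral_of_le hr.1]
          calc _ ≤ ∫ t in Ioc s₀ r, |t ^ (N - 1) * a t| * M := by
                refine norm_integral_le_of_norm_le ?_ ?_
                · exact IntegrableOn.mono_set (haint.abs.mul_const M)
                    (Ioc_subset_Icc_self.trans (Icc_subset_Icc_right (hr.2.trans hd1)))
                · filter_upwards [ae_restrict_mem measurableSet_Ioc] with t ht
                  rw [norm_neg, norm_mul, Real.norm_eq_abs, Real.norm_eq_abs]
                  exact mul_le_mul_of_nonneg_left (hmax ⟨ht.1.le, ht.2.trans hr.2⟩) (abs_nonneg _)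
            _ = (∫ t in Ioc s₀ r, |t ^ (N - 1) * a t|) * M := integral_mul_const _ _
            _ ≤ A * M := by
                refine mul_le_mul_of_nonneg_right (setIntegral_mono_set haint.abs
                  (ae_of_all _ fun t => abs_nonneg _) ?_) (abs_nonneg _)
                exact (Ioc_subset_Icc_self.trans
                  (Icc_subset_Icc_right (hr.2.trans hd1))).eventuallyLE
        rw [← h1, norm_mul, norm_pow, Real.norm_of_nonneg (hs₀.1.le.trans hr.1)] at h2
        rw [hC, div_mul_eq_mul_div, le_div_iff₀ hs₀N, mul_comm]
        refine le_trans (mul_le_mul_of_nonneg_right ?_ (norm_nonneg _)) h2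
        exact pow_le_pow_left₀ hs₀.1.le hr.1 _
      have hub : ∀ r ∈ Icc x d, |u r| ≤ M / 2 := by
        intro r hr
        have h1 : ∫ t in x..r, g t = u r - u x := by
          refine intervalIntegral.integral_eq_sub_of_hasDerivAt_of_le hr.1
            (huc.mono (Icc_subset_Icc hx.1 (hr.2.trans hd1))) (fun t ht => ?_)
            (hg.intervalIntegrable _ _)
          have ht1 : t < 1 := ht.2.trans_le (hr.2.trans hd1)
          have ht0 : s₀ < t := hx.1.trans_lt ht.1
          rw [hgu t ⟨ht0.le, ht1⟩]
          exact hu.2.1 t ⟨hs₀.1.trans ht0, ht1⟩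
        have h2 := intervalIntegral.norm_integral_le_of_norm_le_const (a := x) (b := r) (f := g)
          (C := C * M) (fun t ht => by
            rw [uIoc_of_le hr.1] at ht
            exact hgb t ⟨hx.1.trans ht.1.le, ht.2.trans hr.2⟩)
        rw [h1, hx0 x ⟨hx.1, le_rfl⟩, sub_zero, Real.norm_eq_abs,
          abs_of_nonneg (sub_nonneg.2 hr.1)] at h2
        refine h2.trans ?_
        have h3 : r - x ≤ 1 / (2 * (C + 1)) := by linarith [hr.2]
        have hM0 : 0 ≤ M := abs_nonneg _
        calc C * M * (r - x) ≤ (C + 1) * M * (1 / (2 * (C + 1))) := by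
              refine mul_le_mul (mul_le_mul_of_nonneg_right (by linarith) hM0) h3
                (by linarith [hr.1]) (by positivity)
          _ = M / 2 := by field_simp
      have hM0 : M = 0 := by
        have : M ≤ M / 2 := by
          rcases le_total m x with h | h
          · have : M = 0 := by rw [hM, hx0 m ⟨hm.1, h⟩, abs_zero]
            linarith
          · exact hub m ⟨h, hm.2⟩
        have : 0 ≤ M := abs_nonneg _
        linarith
      intro r hr
      have : |u r| ≤ M := hmax hr
      rw [hM0] at this
      exact abs_nonpos_iff.1 this
  intro r hr
  rcases lt_or_ge r s₀ with h | h
  · exact h0 r ⟨hr.1, h.trans hs₀.2⟩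
  · exact hfar ⟨h, hr.2⟩ r ⟨h, le_rfl⟩

end IsRadialH1Solution

/-- Hölder's inequality for the potential term of the energy. -/
lemma omegaN_mul_integral_le (N : ℕ) {p q ε z : ℝ} (hp : 1 < p) (hq : q = 2 * p / (p - 1))
    (hε : 0 < ε) (hεz : ε < z) (hz : z ≤ 1) {a u : ℝ → ℝ} (hmeas : Measurable a)
    (ha : RadialMemLp N p a) (hu : ContinuousOn u (Icc ε z)) :
    omegaN N * ∫ r in ε..z, r ^ (N - 1) * a r * u r ^ 2 ≤
      (omegaN N * ∫ r in (0:ℝ)..z, r ^ (N - 1) * |a r| ^ p) ^ (1 / p) *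
        (omegaN N * ∫ r in ε..z, r ^ (N - 1) * |u r| ^ q) ^ (2 / q) := by
  have hω := omegaN_nonneg N
  have hp0 : 0 < p := by linarith
  have hp1 : 0 < p - 1 := by linarith
  set p' := p / (p - 1) with hp'
  have hp'0 : 0 < p' := by positivity
  have hpq : p.HolderConjugate p' := by
    rw [Real.holderConjugate_iff]
    refine ⟨hp, ?_⟩
    rw [hp']; field_simp; ring
  have hinv : 1 / p + 1 / p' = 1 := by simpa using hpq.inv_add_inv_eq_one
  have hqp' : q = 2 * p' := by rw [hq, hp']; ring
  have h2q : 2 / q = 1 / p' := by rw [hqp']; field_simp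
  have hz0 : 0 < z := hε.trans hεz
  set f : ℝ → ℝ := fun t => (t ^ (N - 1)) ^ (1 / p) * |a t| with hf
  set g : ℝ → ℝ := fun t => (t ^ (N - 1)) ^ (1 / p') * u t ^ 2 with hg
  have hpos : ∀ t ∈ Ioc ε z, 0 < t ^ (N - 1) := fun t ht => pow_pos (hε.trans ht.1) _
  have hfp : ∀ t ∈ Ioc ε z, f t ^ p = t ^ (N - 1) * |a t| ^ p := by
    intro t ht
    have := hpos t ht
    simp only [hf]
    rw [Real.mul_rpow (by positivity) (by positivity), ← Real.rpow_mul this.le,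
      one_div_mul_cancel hp0.ne', Real.rpow_one]
  have hgp : ∀ t ∈ Ioc ε z, g t ^ p' = t ^ (N - 1) * |u t| ^ q := by
    intro t ht
    have := hpos t ht
    simp only [hg]
    rw [Real.mul_rpow (by positivity) (by positivity), ← Real.rpow_mul this.le,
      one_div_mul_cancel hp'0.ne', Real.rpow_one, ← sq_abs, ← Real.rpow_natCast |u t| 2,
      ← Real.rpow_mul (abs_nonneg _), hqp']
    norm_num
  have hf0 : ∀ t ∈ Ioc ε z, 0 ≤ f t := fun t ht => by
    have := hpos t ht
    positivity
  have hg0 : ∀ t ∈ Ioc ε z, 0 ≤ g t := fun t ht => by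
    have := hpos t ht
    positivity
  have ha0 : IntegrableOn (fun r => r ^ (N - 1) * |a r| ^ p) (Ioc 0 z) :=
    (integrableOn_Icc_iff_integrableOn_Ioo enorm_ne_top enorm_ne_top |>.2 ha).mono_set
      (Ioc_subset_Icc_self.trans (Icc_subset_Icc_right hz))
  have hIoc : Ioc ε z ⊆ Ioc 0 z := Ioc_subset_Ioc_left hε.le
  have hgc : ContinuousOn g (Icc ε z) :=
    ((continuous_pow (N - 1)).continuousOn.rpow_const fun t _ => Or.inr (by positivity)).mul
      (hu.pow 2)
  have hfL : MemLp f (ENNReal.ofReal p) (volume.restrict (Ioc ε z)) := by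
    rw [← integrable_norm_rpow_iff (by fun_prop) (by simpa using hp0) ENNReal.ofReal_ne_top,
      ENNReal.toReal_ofReal hp0.le]
    refine (ha0.mono_set hIoc).congr_fun (fun t ht => ?_) measurableSet_Ioc
    simp only
    rw [Real.norm_of_nonneg (hf0 t ht), hfp t ht]
  have hgL : MemLp g (ENNReal.ofReal p') (volume.restrict (Ioc ε z)) := by
    rw [← integrable_norm_rpow_iff ((hgc.mono Ioc_subset_Icc_self).aestronglyMeasurable
      measurableSet_Ioc) (by simpa using hp'0) ENNReal.ofReal_ne_top,
      ENNReal.toReal_ofReal hp'0.le]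
    exact ((hgc.norm.rpow_const fun t _ => Or.inr hp'0.le).integrableOn_Icc).mono_set
      Ioc_subset_Icc_self
  have hfg : IntegrableOn (fun t => f t * g t) (Ioc ε z) := by
    have : ENNReal.HolderConjugate (ENNReal.ofReal p) (ENNReal.ofReal p') := hpq.ennrealOfReal
    exact hfL.integrable_mul hgL
  have hold := integral_mul_le_Lp_mul_Lq_of_nonneg hpq (ae_restrict_of_forall_mem
    measurableSet_Ioc hf0) (ae_restrict_of_forall_mem measurableSet_Ioc hg0) hfL hgL
  rw [setIntegral_congr_fun measurableSet_Ioc hfp,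
    setIntegral_congr_fun measurableSet_Ioc hgp] at hold
  have hle : ∫ r in ε..z, r ^ (N - 1) * a r * u r ^ 2 ≤ ∫ t in Ioc ε z, f t * g t := by
    rw [intervalIntegral.integral_of_le hεz.le]
    refine (Real.le_norm_self _).trans (norm_integral_le_of_norm_le hfg ?_)
    refine ae_restrict_of_forall_mem measurableSet_Ioc fun t ht => le_of_eq ?_
    have h1 := hpos t ht
    simp only [hf, hg]
    rw [norm_mul, norm_mul, Real.norm_of_nonneg h1.le, Real.norm_of_nonneg (sq_nonneg (u t)),
      Real.norm_eq_abs]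
    calc t ^ (N - 1) * |a t| * u t ^ 2
        = ((t ^ (N - 1)) ^ (1 / p) * (t ^ (N - 1)) ^ (1 / p')) * |a t| * u t ^ 2 := by
          rw [← Real.rpow_add h1, hinv, Real.rpow_one]
      _ = _ := by ring
  have hU0 : 0 ≤ ∫ t in Ioc ε z, t ^ (N - 1) * |u t| ^ q :=
    setIntegral_nonneg measurableSet_Ioc fun t ht => by
      have := hpos t ht
      positivity
  have hA0 : 0 ≤ ∫ t in Ioc ε z, t ^ (N - 1) * |a t| ^ p :=
    setIntegral_nonneg measurableSet_Ioc fun t ht => by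
      have := hpos t ht
      positivity
  have hAle : ∫ t in Ioc ε z, t ^ (N - 1) * |a t| ^ p ≤
      ∫ t in Ioc 0 z, t ^ (N - 1) * |a t| ^ p := by
    refine setIntegral_mono_set ha0 (ae_restrict_of_forall_mem measurableSet_Ioc fun t ht => ?_)
      hIoc.eventuallyLE
    have := ht.1
    simp only [Pi.zero_apply]; positivity
  rw [h2q, intervalIntegral.integral_of_le hz0.le, intervalIntegral.integral_of_le hεz.le
    (f := fun r => r ^ (N - 1) * |u r| ^ q), Real.mul_rpow hω (hA0.trans hAle),
    Real.mul_rpow hω hU0]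
  have hω1 : omegaN N = omegaN N ^ (1 / p) * omegaN N ^ (1 / p') := by
    rw [← Real.rpow_add' hω (by rw [hinv]; norm_num), hinv, Real.rpow_one]
  calc omegaN N * ∫ r in ε..z, r ^ (N - 1) * a r * u r ^ 2
      ≤ omegaN N * ((∫ t in Ioc 0 z, t ^ (N - 1) * |a t| ^ p) ^ (1 / p) *
          (∫ t in Ioc ε z, t ^ (N - 1) * |u t| ^ q) ^ (1 / p')) := by
        refine mul_le_mul_of_nonneg_left (hle.trans (hold.trans ?_)) hω
        gcongr
    _ = (omegaN N ^ (1 / p) * omegaN N ^ (1 / p')) *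
          ((∫ t in Ioc 0 z, t ^ (N - 1) * |a t| ^ p) ^ (1 / p) *
          (∫ t in Ioc ε z, t ^ (N - 1) * |u t| ^ q) ^ (1 / p')) := by rw [← hω1]
    _ = _ := by ring

/-- If `u` is a nontrivial radial `H^1` solution of `Δu + a u = 0` in `B_1`
with `u(z) = 0` for some `z ∈ (0,1]`, and `a` is a radial `L^p` function with `p > N/2`,
`q = 2p/(p-1)`, then `(ω_N ∫_0^z r^(N-1) |a(r)|^p dr)^(1/p) ≥ z^(N/p - 2) α(N,p)`, where
`α(N,p)` is the Sobolev quotient of the unit ball. -/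
theorem stmt19 (N : ℕ) (hN : 2 ≤ N) (p q : ℝ) (hp : (N : ℝ) / 2 < p)
    (hq : q = 2 * p / (p - 1))
    (a : ℝ → ℝ) (hmeas : Measurable a) (ha : RadialMemLp N p a)
    (u u' : ℝ → ℝ) (hu : IsRadialH1Solution N a u u')
    (hnt : ∃ r ∈ Ioc (0:ℝ) 1, u r ≠ 0)
    (z : ℝ) (hz : z ∈ Ioc (0:ℝ) 1) (huz : u z = 0) :
    z ^ ((N : ℝ) / p - 2) * sobolevQuot N q 1 ≤
      (omegaN N * ∫ r in (0:ℝ)..z, r ^ (N - 1) * |a r| ^ p) ^ (1 / p) := by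
  have hN' : (2 : ℝ) ≤ N := by exact_mod_cast hN
  have hp1 : 1 < p := by linarith
  have hq0 : 0 < q := by rw [hq]; exact div_pos (by linarith) (by linarith)
  have hz0 := hz.1
  have hω : 0 < omegaN N := by
    unfold omegaN
    have : 0 < (volume (Metric.ball (0 : EuclideanSpace ℝ (Fin N)) 1)).toReal :=
      ENNReal.toReal_pos (Metric.measure_ball_pos _ _ one_pos).ne' measure_ball_lt_top.ne
    positivity
  have haint := ha.integrableOn_pow_mul hp1 hmeas
  obtain ⟨δ, hδ, huδ⟩ : ∃ δ ∈ Ioo 0 z, u δ ≠ 0 := by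
    by_contra! h
    obtain ⟨r, hr, hur⟩ := hnt
    exact hur (hu.eq_zero_of_eq_zero_near_zero haint hz h r hr)
  have hucont : ∀ ε, 0 < ε → ContinuousOn u (Icc ε z) := fun ε hε =>
    hu.1.mono fun r hr => ⟨hε.trans_le hr.1, hr.2.trans hz.2⟩
  have hcont : ∀ ε, 0 < ε → ContinuousOn (fun r => r ^ (N - 1) * |u r| ^ q) (Icc ε z) :=
    fun ε hε => (continuous_pow (N - 1)).continuousOn.mul
      ((hucont ε hε).abs.rpow_const fun _ _ => Or.inr hq0.le)
  have hI0 : 0 < omegaN N * ∫ r in δ..z, r ^ (N - 1) * |u r| ^ q := by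
    refine mul_pos hω (intervalIntegral.integral_pos hδ.2 (hcont δ hδ.1) (fun r hr => ?_)
      ⟨δ, left_mem_Icc.2 hδ.2.le, ?_⟩)
    · have := hδ.1.trans hr.1
      positivity
    · have := hδ.1
      positivity
  by_contra! hlt
  set A := (omegaN N * ∫ r in (0:ℝ)..z, r ^ (N - 1) * |a r| ^ p) ^ (1 / p) with hA
  set S := z ^ ((N : ℝ) / p - 2) * sobolevQuot N q 1 with hS
  have hI0' := Real.rpow_pos_of_pos hI0 (2 / q)
  obtain ⟨ε, hε, hflux⟩ := hu.exists_neg_flux_lt hN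
    (c := (S - A) * (omegaN N * ∫ r in δ..z, r ^ (N - 1) * |u r| ^ q) ^ (2 / q) / omegaN N)
    (div_pos (mul_pos (sub_pos.2 hlt) hI0') hω) hδ.1 (hδ.2.trans_le hz.2)
  rw [lt_div_iff₀ hω] at hflux
  have hεz : ε < z := hε.2.trans_lt hδ.2
  obtain ⟨g, hg, hgu, hgP⟩ := hu.exists_continuous_deriv haint ⟨hε.1, hεz.trans_le hz.2⟩
  have hsob := rpow_mul_sobolevQuot_mul_le_interval N hN hp1 hq hε.1 hεz (hucont ε hε.1) hg
    (fun r hr => by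
      have hr1 : r < 1 := hr.2.trans_le hz.2
      rw [hgu r ⟨hr.1.le, hr1⟩]
      exact hu.2.1 r ⟨hε.1.trans hr.1, hr1⟩) huz
  rw [hu.integral_sq_deriv_eq haint hε.1 hεz hz.2 huz hg hgu hgP, mul_sub] at hsob
  have hhol := omegaN_mul_integral_le N hp1 hq hε.1 hεz hz.2 hmeas ha (hucont ε hε.1)
  have hmono : (omegaN N * ∫ r in δ..z, r ^ (N - 1) * |u r| ^ q) ^ (2 / q) ≤
      (omegaN N * ∫ r in ε..z, r ^ (N - 1) * |u r| ^ q) ^ (2 / q) := by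
    refine Real.rpow_le_rpow hI0.le (mul_le_mul_of_nonneg_left ?_ hω.le) (by positivity)
    refine intervalIntegral.integral_mono_interval hε.2 hδ.2.le le_rfl
      (ae_restrict_of_forall_mem measurableSet_Ioc fun r hr => ?_)
      ((hcont ε hε.1).intervalIntegrable_of_Icc hεz.le)
    have := hε.1.trans hr.1
    simp only [Pi.zero_apply]; positivity
  have hfinal := mul_le_mul_of_nonneg_left hmono (sub_pos.2 hlt).le
  linarith
end
end
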